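/- arXiv:1906.08046 — 2 statements merged into one kernel-verified Lean document; each statement's English description precedes it below -/
import Mathlib

section
/- Fix integers n ≥ 2 and r ≥ 1. There exists a constant T_r(n) such that for every prime power q > T_r(n) with r | q^n − 1 and every θ with F_{q^n} = F_q(θ), there exists x ∈ F_q such that θ + x has multiplicative order (q^n − 1)/r. -/
open Polynomial Finset

section AuxiliaryPolynomial

variable {R K : Type*} [CommSemiring R] [Field K]

/-- The coefficient of `Y ^ m` of a bivariate polynomial has degree at most `a + b * m`. -/
def CoeffDegreeLE (b a : ℕ) (E : R[X][X]) : Prop :=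
  ∀ m, (E.coeff m).natDegree ≤ a + b * m

theorem CoeffDegreeLE.mul {b a₁ a₂ : ℕ} {E₁ E₂ : R[X][X]} (h₁ : CoeffDegreeLE b a₁ E₁)
    (h₂ : CoeffDegreeLE b a₂ E₂) : CoeffDegreeLE b (a₁ + a₂) (E₁ * E₂) := by
  intro m
  rw [coeff_mul]
  refine natDegree_sum_le_of_forall_le _ _ fun x hx => ?_
  rw [HasAntidiagonal.mem_antidiagonal] at hx
  calc _ ≤ (a₁ + b * x.1) + (a₂ + b * x.2) :=
        natDegree_mul_le.trans (add_le_add (h₁ _) (h₂ _))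
    _ = _ := by rw [← hx]; ring

theorem CoeffDegreeLE.C {b a : ℕ} {p : R[X]} (h : p.natDegree ≤ a) :
    CoeffDegreeLE b a (C p) := by
  intro m
  rw [coeff_C]
  split_ifs
  · exact h.trans (Nat.le_add_right _ _)
  · simp

theorem CoeffDegreeLE.pow {b a : ℕ} {E : R[X][X]} (h : CoeffDegreeLE b a E) (k : ℕ) :
    CoeffDegreeLE b (k * a) (E ^ k) := by
  induction k with
  | zero => simpa using CoeffDegreeLE.C (b := b) (a := 0) (p := (1 : R[X])) (by simp)
  | succ k ih => simpa [pow_succ, add_mul] using ih.mul h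

theorem CoeffDegreeLE.prod {ι : Type*} {b : ℕ} (s : Finset ι) {E : ι → R[X][X]}
    (h : ∀ i ∈ s, CoeffDegreeLE b 0 (E i)) : CoeffDegreeLE b 0 (∏ i ∈ s, E i) := by
  classical
  induction s using Finset.induction_on with
  | empty => simpa using CoeffDegreeLE.C (b := b) (a := 0) (p := (1 : R[X])) (by simp)
  | insert i s hi ih =>
    rw [prod_insert hi]
    simpa using (h i (mem_insert_self _ _)).mul (ih fun j hj => h j (mem_insert_of_mem hj))

theorem CoeffDegreeLE.C_add_C_mul_X {b a : ℕ} {p w : R[X]} (hp : p.natDegree ≤ a)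
    (hw : w.natDegree ≤ a + b) : CoeffDegreeLE b a (Polynomial.C p + Polynomial.C w * X) := by
  intro m
  rcases m with _ | _ | m
  · simpa using hp
  · simpa [coeff_C] using hw
  · simp

theorem eq_zero_of_sum_X_pow_mul_eq_zero {ι : Type*} [Fintype ι] {v : ι → ℕ}
    (hv : Function.Injective v) {H : ι → K[X]} (hH : ∀ i, (H i).coeff 0 ≠ 0) {α : ι → K}
    (h : ∑ i, C (α i) * (X ^ v i * H i) = 0) : α = 0 := by
  classical
  by_contra hα
  obtain ⟨i₀, hi₀⟩ := Function.ne_iff.mp hα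
  obtain ⟨i, hi, hmin⟩ := exists_min_image (univ.filter fun i => α i ≠ 0) v
    ⟨i₀, by simpa using hi₀⟩
  rw [mem_filter] at hi
  have hc := congrArg (fun p => p.coeff (v i)) h
  simp only [finsetSum_coeff, coeff_C_mul, coeff_zero] at hc
  rw [sum_eq_single i] at hc
  · rw [coeff_X_pow_mul'] at hc
    simp [hi.2, hH i] at hc
  · intro j _ hj
    by_cases hαj : α j = 0
    · simp [hαj]
    · have hle := hmin j (by simp [hαj])
      have hne : v j ≠ v i := fun h => hj (hv h)
      rw [coeff_X_pow_mul', if_neg (by omega), mul_zero]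
  · simp

/-- The method of auxiliary polynomials: if a linear combination of the linearly independent
polynomials `A i` can be made to vanish to order `M` on `S` by solving fewer than `card ι` linear
equations, then `M * #S` is bounded by the degree. -/
theorem mul_card_le_of_comp_congr {ι : Type*} [Fintype ι] (A : ι → K[X]) (E : ι → K[X][X])
    (S : Finset K) (w : K[X]) {M B D : ℕ} (hA : ∀ i, (A i).natDegree ≤ D)
    (hlin : ∀ α : ι → K, ∑ i, C (α i) * A i = 0 → α = 0)
    (hE : ∀ i, ∀ m < M, ((E i).coeff m).natDegree < B)
    (hw : ∀ u ∈ S, w.eval u ≠ 0)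
    (hdvd : ∀ u ∈ S, ∀ i,
      X ^ M ∣ (A i).comp (C u + C (w.eval u) * X) - (E i).map (evalRingHom u))
    (hcard : M * B < Fintype.card ι) : M * #S ≤ D := by
  classical
  let Φ : (ι → K) →ₗ[K] (Fin M × Fin B → K) :=
    { toFun := fun α x => ∑ i, α i * ((E i).coeff x.1).coeff x.2
      map_add' := fun α β => by ext x; simp [add_mul, sum_add_distrib]
      map_smul' := fun a α => by ext x; simp [mul_sum, mul_assoc] }
  have hker : LinearMap.ker Φ ≠ ⊥ := LinearMap.ker_ne_bot_of_finrank_lt (by simpa using hcard)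
  obtain ⟨α, hα, hα0⟩ := Submodule.exists_mem_ne_zero_of_ne_bot hker
  have hcoef : ∀ m < M, ∑ i, C (α i) * (E i).coeff m = 0 := by
    intro m hm
    ext k
    simp only [finsetSum_coeff, coeff_C_mul, coeff_zero]
    by_cases hk : k < B
    · exact congrFun hα (⟨m, hm⟩, ⟨k, hk⟩)
    · refine sum_eq_zero fun i _ => ?_
      rw [coeff_eq_zero_of_natDegree_lt ((hE i m hm).trans_le (not_lt.mp hk)), mul_zero]
  set P : K[X] := ∑ i, C (α i) * A i with hP
  have hP0 : P ≠ 0 := fun h => hα0 (hlin α h)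
  have hPdeg : P.natDegree ≤ D :=
    natDegree_sum_le_of_forall_le _ _ fun i _ => (natDegree_C_mul_le _ _).trans (hA i)
  have hroot : ∀ u ∈ S, (X - C u) ^ M ∣ P := by
    intro u hu
    have h₁ : X ^ M ∣ P.comp (C u + C (w.eval u) * X) := by
      have h₂ : X ^ M ∣ ∑ i, C (α i) * (E i).map (evalRingHom u) := by
        rw [X_pow_dvd_iff]
        intro m hm
        have := congrArg (eval u) (hcoef m hm)
        simpa [eval_finsetSum, finsetSum_coeff] using this
      have h₃ : X ^ M ∣ ∑ i, C (α i) *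
          ((A i).comp (C u + C (w.eval u) * X) - (E i).map (evalRingHom u)) :=
        dvd_sum fun i _ => (hdvd u hu i).mul_left _
      have h₄ := dvd_add h₃ h₂
      rw [← sum_add_distrib] at h₄
      simpa [hP, ← mul_add, Polynomial.sum_comp] using h₄
    have h₅ := map_dvd (compRingHom (C (w.eval u)⁻¹ * (X - C u))) h₁
    simp only [coe_compRingHom_apply, comp_assoc] at h₅
    have h₆ : (C u + C (w.eval u) * X).comp (C (w.eval u)⁻¹ * (X - C u)) = X := by
      have : C (w.eval u) * C (w.eval u)⁻¹ = 1 := by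
        rw [← C_mul, mul_inv_cancel₀ (hw u hu), C_1]
      simp [← mul_assoc, this]
    rw [h₆, comp_X, X_pow_comp, mul_pow] at h₅
    exact (Dvd.intro_left _ rfl).trans h₅
  have hprod : ∏ u ∈ S, (X - C u) ^ M ∣ P :=
    prod_dvd_of_coprime
      (fun u _ v _ huv => ((pairwise_coprime_X_sub_C Function.injective_id) huv).pow) hroot
  have := natDegree_le_of_dvd hprod hP0
  rw [prod_pow, natDegree_pow, natDegree_prod_of_monic _ _ fun u _ => monic_X_sub_C u] at this
  simp only [natDegree_X_sub_C, sum_const, smul_eq_mul, mul_one] at this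
  exact this.trans hPdeg

end AuxiliaryPolynomial

theorem sum_div_pow_mod_mul_pow (q n N : ℕ) :
    ∑ i ∈ range n, N / q ^ i % q * q ^ i = N % q ^ n := by
  induction n with
  | zero => simp [Nat.mod_one]
  | succ n ih => rw [sum_range_succ, ih, pow_succ, Nat.mod_mul]; ring

/-- The multiples `j * e` of `e = (Q - 1) / d` modulo `q` are well spaced. -/
theorem mul_mod_add_injective {q Q d e L : ℕ} (hq : q ∣ Q) (hde : d * e + 1 = Q)
    (hL : d * (L + 1) ≤ q) {j j' k k' s s' : ℕ} (hj : j < d) (hj' : j' < d) (hs : s < L)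
    (hs' : s' < L)
    (h : q * k + j * e % q + s = q * k' + j' * e % q + s') : j = j' ∧ k = k' ∧ s = s' := by
  obtain ⟨Q', rfl⟩ := hq
  have hm := Nat.div_add_mod (j * e) q
  have hm' := Nat.div_add_mod (j' * e) q
  have hkey : (q : ℤ) ∣ (j' - j : ℤ) + d * (s - s') := by
    refine ⟨-(d * k - d * k' + j * Q' - j' * Q' - d * (j * e / q) + d * (j' * e / q)), ?_⟩
    zify at h hde hm hm'
    linear_combination (d : ℤ) * h + (j' - j : ℤ) * hde - (d : ℤ) * hm + d * hm'
  have habs : |(j' - j : ℤ) + d * (s - s')| < q := by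
    have h1 : |(j' - j : ℤ)| ≤ d - 1 := by rw [abs_le]; omega
    have h2 : |(s - s' : ℤ)| ≤ L - 1 := by rw [abs_le]; omega
    calc _ ≤ |(j' - j : ℤ)| + |(d : ℤ) * (s - s')| := abs_add_le _ _
      _ ≤ (d - 1) + d * (L - 1) := by
        rw [abs_mul, Nat.abs_cast]; gcongr
      _ < q := by zify at hL; nlinarith
  have hzero := Int.eq_zero_of_abs_lt_dvd hkey habs
  have hss : (s : ℤ) = s' := by
    by_contra hne
    have h1 : 1 ≤ |(s - s' : ℤ)| := Int.one_le_abs (sub_ne_zero.mpr hne)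
    have h2 : (d : ℤ) * |(s - s' : ℤ)| = |(j' - j : ℤ)| := by
      rw [← Nat.abs_cast d, ← abs_mul, show (d : ℤ) * (s - s') = -(j' - j) by linarith, abs_neg]
    have h3 : |(j' - j : ℤ)| ≤ d - 1 := by rw [abs_le]; omega
    nlinarith
  have hjj : j = j' := by
    rw [hss, sub_self, mul_zero] at hzero
    omega
  have hs2 : s = s' := by omega
  subst hjj hs2
  refine ⟨rfl, ?_, rfl⟩
  have : q * k = q * k' := by omega
  exact Nat.eq_of_mul_eq_mul_left (by nlinarith) this

/-- Stepanov's bound for a fibre of `u ↦ u ^ e`, `d * e = q ^ n - 1`, on a set on which the powers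
of the `q`-Frobenius act as translations. -/
theorem mul_card_le_of_pow_eq {K : Type*} [Field K] {p f q n d e t : ℕ} [ExpChar K p]
    (hq : q = p ^ f) (hn : 1 ≤ n) (hde : d * e + 1 = q ^ n) {c : ℕ → K} (hc0 : c 0 = 0)
    (hc : ∀ i, 0 < i → i < n → c i ≠ 0) {S : Finset K} (hS0 : ∀ u ∈ S, u ≠ 0)
    (hS : ∀ u ∈ S, ∀ i, u ^ q ^ i = u + c i) {ζ : K} (hζ : ∀ u ∈ S, u ^ e = ζ) (hd : 1 ≤ d)
    (ht : 1 ≤ t) (hsize : (n + 1) * (d * t) ^ 2 + 2 * d ≤ q) :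
    d * t * #S ≤ q * (t + n + 1) := by
  classical
  set M := d * t with hM
  set L := q / d - 1 with hL
  have hq2 : 2 * d ≤ q := by omega
  have hM1 : 1 ≤ M := Nat.mul_pos hd ht
  have hMM : M ≤ M ^ 2 := Nat.le_self_pow two_ne_zero _
  have hM2 : (n + 1) * M ^ 2 = n * M ^ 2 + M ^ 2 := by ring
  have hMq : M ≤ q := by omega
  have hdiv := Nat.div_add_mod q d
  have hmod := Nat.mod_lt q hd
  have hqd : 1 ≤ q / d := (Nat.one_le_div_iff hd).mpr (by omega)
  have hLq : L + 1 = q / d := by omega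
  have hdL : d * (L + 1) ≤ q := by rw [hLq]; exact Nat.mul_div_le q d
  have hdL' : d * (L + 1) = d * L + d := by ring
  have hdL2 : q < d * L + 2 * d := by rw [← hLq] at hdiv; omega
  let a : ℕ → ℕ → ℕ := fun j i => j * e / q ^ i % q
  have ha : ∀ j < d, ∑ i ∈ range n, a j i * q ^ i = j * e := by
    intro j hj
    rw [sum_div_pow_mod_mul_pow, Nat.mod_eq_of_lt]
    have : j * e ≤ d * e := Nat.mul_le_mul_right _ hj.le
    omega
  let w : K[X] := ∏ i ∈ range n, (X + C (c i))
  let w' : ℕ → K[X] := fun i => ∏ i' ∈ (range n).erase i, (X + C (c i'))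
  have hww' : ∀ i ∈ range n, (X + C (c i)) * w' i = w := fun i hi =>
    mul_prod_erase (range n) (fun i => X + C (c i)) hi
  let A : Fin d × Fin (t + 1) × Fin L → K[X] := fun x =>
    X ^ (x.2.2 : ℕ) * (∏ i ∈ range n, (X + C (c i)) ^ a x.1 i) * (X ^ q) ^ (x.2.1 : ℕ)
  let E : Fin d × Fin (t + 1) × Fin L → K[X][X] := fun x =>
    C (C (ζ ^ (x.1 : ℕ)) * (X + C (c 1)) ^ (x.2.1 : ℕ)) * (C X + C w * X) ^ (x.2.2 : ℕ) *
      ∏ i ∈ range n, (C 1 + C (w' i) * X) ^ a x.1 i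
  have hwdeg : w.natDegree ≤ n := by
    refine (natDegree_prod_le _ _).trans ?_
    simp
  have hw'deg : ∀ i ∈ range n, (w' i).natDegree ≤ n - 1 := by
    intro i hi
    refine (natDegree_prod_le _ _).trans ?_
    simp [card_erase_of_mem hi]
  have hEdeg : ∀ x, CoeffDegreeLE (n - 1) (x.2.1 + x.2.2 * 1 + 0) (E x) := by
    intro x
    refine ((CoeffDegreeLE.C ?_).mul ((CoeffDegreeLE.C_add_C_mul_X ?_ ?_).pow _)).mul
      (CoeffDegreeLE.prod _ fun i hi => ?_)
    · refine (natDegree_C_mul_le _ _).trans (natDegree_pow_le.trans ?_)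
      simp
    · simp
    · omega
    · simpa using (CoeffDegreeLE.C_add_C_mul_X (a := 0) (b := n - 1) (p := 1) (w := w' i)
        (by simp) (by simpa using hw'deg i hi)).pow (a x.1 i)
  have hwne : ∀ u ∈ S, ∀ i, u + c i ≠ 0 := fun u hu i => by
    rw [← hS u hu i]; exact pow_ne_zero _ (hS0 u hu)
  have hweval : ∀ u, w.eval u = ∏ i ∈ range n, (u + c i) := fun u => by simp [w, eval_prod]
  refine mul_card_le_of_comp_congr A E S w (B := L + t + 1 + (n - 1) * M) ?_ ?_ ?_ ?_ ?_ ?_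
  · intro x
    have h1 : (∏ i ∈ range n, (X + C (c i)) ^ a x.1 i : K[X]).natDegree ≤ n * q := by
      refine (natDegree_prod_le _ _).trans ((sum_le_card_nsmul _ _ q fun i _ => ?_).trans (by simp))
      refine natDegree_pow_le.trans ?_
      rw [natDegree_X_add_C, mul_one]
      exact (Nat.mod_lt _ (by omega)).le
    have h2 : (x.2.1 : ℕ) ≤ t := by omega
    have h3 : (x.2.2 : ℕ) ≤ q := by
      have : q / d ≤ q := Nat.div_le_self _ _
      omega
    calc (A x).natDegree ≤ x.2.2 + n * q + q * x.2.1 := by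
          refine natDegree_mul_le.trans (add_le_add (natDegree_mul_le.trans
            (add_le_add (by simp) h1)) ?_)
          rw [← pow_mul, natDegree_X_pow]
      _ ≤ q + n * q + q * t := by gcongr
      _ = q * (t + n + 1) := by ring
  · intro α hα
    obtain ⟨n, rfl⟩ : ∃ m, n = m + 1 := ⟨n - 1, by omega⟩
    refine eq_zero_of_sum_X_pow_mul_eq_zero
      (v := fun x : Fin d × Fin (t + 1) × Fin L => q * x.2.1 + x.1 * e % q + x.2.2)
      (H := fun x => ∏ i ∈ range n, (X + C (c (i + 1))) ^ a x.1 (i + 1)) ?_ ?_ ?_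
    · rintro ⟨j, k, s⟩ ⟨j', k', s'⟩ h
      obtain ⟨h1, h2, h3⟩ := mul_mod_add_injective (dvd_pow_self q (by omega)) hde hdL
        j.2 j'.2 s.2 s'.2 h
      simp only [Prod.mk.injEq]
      exact ⟨Fin.ext h1, Fin.ext h2, Fin.ext h3⟩
    · intro x
      rw [coeff_zero_eq_eval_zero, eval_prod, prod_ne_zero_iff]
      intro i hi
      simp only [eval_pow, eval_add, eval_X, eval_C, zero_add]
      exact pow_ne_zero _ (hc _ (by omega) (by simpa using hi))
    · rw [← hα]
      refine sum_congr rfl fun x _ => ?_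
      congr 1
      simp only [A]
      rw [prod_range_succ']
      simp only [hc0, a, pow_zero, Nat.div_one, C_0, add_zero]
      ring
  · intro x m hm
    refine (hEdeg x m).trans_lt ?_
    have h1 := x.2.1.2
    have h2 := x.2.2.2
    have h3 : (n - 1) * m ≤ (n - 1) * M := Nat.mul_le_mul_left _ hm.le
    omega
  · intro u hu
    rw [hweval]
    exact prod_ne_zero_iff.mpr fun i _ => hwne u hu i
  · intro u hu x
    have hζu : ∏ i ∈ range n, (u + c i) ^ a x.1 i = ζ ^ (x.1 : ℕ) := by
      rw [← hζ u hu, ← pow_mul, mul_comm e, ← ha x.1 x.1.2, ← prod_pow_eq_pow_sum]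
      refine prod_congr rfl fun i _ => ?_
      rw [← hS u hu i, ← pow_mul, mul_comm]
    have hlin : ∀ i ∈ range n, (C u + C (w.eval u) * X + C (c i) : K[X]) =
        C (u + c i) * (C 1 + C ((w' i).eval u) * X) := by
      intro i hi
      have := congrArg (eval u) (hww' i hi)
      simp only [eval_mul, eval_add, eval_X, eval_C] at this
      rw [← this]
      simp only [C_add, C_mul, C_1]
      ring
    have hfrob : (C u + C (w.eval u) * X : K[X]) ^ q =
        (C u + C (c 1)) + C (w.eval u) ^ q * X ^ q := by
      have h1 := hS u hu 1
      rw [pow_one] at h1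
      rw [← C_add, ← h1, C_pow, ← mul_pow, hq, add_pow_expChar_pow]
    have hprod : ∏ i ∈ range n, (C u + C (w.eval u) * X + C (c i) : K[X]) ^ a x.1 i =
        C (ζ ^ (x.1 : ℕ)) * ∏ i ∈ range n, (C 1 + C ((w' i).eval u) * X) ^ a x.1 i := by
      rw [← hζu, map_prod, ← prod_mul_distrib]
      refine prod_congr rfl fun i hi => ?_
      rw [hlin i hi, mul_pow, C_pow]
    have hcomp : (A x).comp (C u + C (w.eval u) * X) =
        (C u + C (w.eval u) * X) ^ (x.2.2 : ℕ) * (C (ζ ^ (x.1 : ℕ)) *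
          ∏ i ∈ range n, (C 1 + C ((w' i).eval u) * X) ^ a x.1 i) *
          ((C u + C (c 1)) + C (w.eval u) ^ q * X ^ q) ^ (x.2.1 : ℕ) := by
      simp only [A, mul_comp, pow_comp, X_comp, Polynomial.prod_comp, add_comp, C_comp]
      rw [hfrob, hprod]
    have hmap : (E x).map (evalRingHom u) =
        (C u + C (w.eval u) * X) ^ (x.2.2 : ℕ) * (C (ζ ^ (x.1 : ℕ)) *
          ∏ i ∈ range n, (C 1 + C ((w' i).eval u) * X) ^ a x.1 i) *
          (C u + C (c 1)) ^ (x.2.1 : ℕ) := by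
      simp only [E, Polynomial.map_mul, Polynomial.map_pow, Polynomial.map_add, map_C, map_X,
        Polynomial.map_prod, coe_evalRingHom, eval_C, eval_X, eval_one, C_mul, C_pow, C_add]
      ring
    rw [hcomp, hmap, ← mul_sub]
    refine Dvd.dvd.mul_left ?_ _
    refine dvd_trans ?_ (sub_dvd_pow_sub_pow _ _ _)
    rw [add_sub_cancel_left]
    exact (pow_dvd_pow X hMq).mul_left _
  · simp only [Fintype.card_prod, Fintype.card_fin]
    have h1 : t ≤ M := Nat.le_mul_of_pos_left _ hd
    have h2 : M * (t + 1) ≤ 2 * M ^ 2 := by nlinarith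
    obtain ⟨n, rfl⟩ : ∃ m, n = m + 1 := ⟨n - 1, by omega⟩
    rw [Nat.add_sub_cancel]
    have h3 : d * ((t + 1) * L) = M * L + d * L := by rw [hM]; ring
    have h4 : M * (L + t + 1 + n * M) = M * L + M * (t + 1) + n * M ^ 2 := by ring
    rw [h3, h4]
    have h5 : (n + 1 + 1) * M ^ 2 = n * M ^ 2 + 2 * M ^ 2 := by ring
    omega

section Translates

open Classical in
/-- The `x : F` for which the translate `θ + x` satisfies `(θ + x) ^ e = ζ`. -/
noncomputable def translatesPowEq (F : Type*) {K : Type*} [Field F] [Field K] [Fintype F]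
    [Algebra F K] (θ : K) (e : ℕ) (ζ : K) : Finset F :=
  univ.filter fun x => (θ + algebraMap F K x) ^ e = ζ

variable {F K : Type*} [Field F] [Field K] [Fintype F] [Algebra F K]

theorem mem_translatesPowEq {θ : K} {e : ℕ} {ζ : K} {x : F} :
    x ∈ translatesPowEq F θ e ζ ↔ (θ + algebraMap F K x) ^ e = ζ := by
  simp [translatesPowEq]

variable [Fintype K] {q n : ℕ} {θ : K}

theorem finrank_eq_of_card (hF : Fintype.card F = q) (hK : Fintype.card K = q ^ n) :
    Module.finrank F K = n := by
  have h : Fintype.card K = q ^ Module.finrank F K := by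
    rw [← hF]; exact Module.card_eq_pow_finrank
  have hq : 1 < q := hF ▸ Fintype.one_lt_card
  exact Nat.pow_right_injective hq (h.symm.trans hK)

theorem pow_card_pow_ne_self (hF : Fintype.card F = q) (hK : Fintype.card K = q ^ n)
    (hθ : Algebra.adjoin F {θ} = ⊤) {i : ℕ} (hi : 0 < i) (hin : i < n) : θ ^ q ^ i ≠ θ := by
  intro h
  have happly : ∀ (i : ℕ) (y : K), (FiniteField.frobeniusAlgHom F K ^ i) y = y ^ q ^ i := by
    intro i
    induction i with
    | zero => simp
    | succ i ih =>
      intro y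
      rw [pow_succ', AlgHom.mul_apply, ih, FiniteField.coe_frobeniusAlgHom, hF]
      dsimp only
      rw [← pow_mul, pow_succ]
  have h1 : FiniteField.frobeniusAlgHom F K ^ i = 1 :=
    AlgHom.ext_of_adjoin_eq_top hθ fun y hy => by
      rw [Set.mem_singleton_iff] at hy
      rw [hy, happly, h, AlgHom.one_apply]
  have h2 := orderOf_dvd_of_pow_eq_one h1
  rw [FiniteField.orderOf_frobeniusAlgHom, finrank_eq_of_card hF hK] at h2
  exact absurd (Nat.le_of_dvd hi h2) (by omega)

theorem add_algebraMap_ne_zero (hF : Fintype.card F = q) (hK : Fintype.card K = q ^ n)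
    (hθ : Algebra.adjoin F {θ} = ⊤) (hn : 2 ≤ n) (x : F) : θ + algebraMap F K x ≠ 0 := by
  intro h
  refine pow_card_pow_ne_self hF hK hθ one_pos hn ?_
  rw [eq_neg_of_add_eq_zero_left h, ← map_neg, pow_one, ← map_pow, ← hF, FiniteField.pow_card]

theorem mul_card_translatesPowEq_le (hF : Fintype.card F = q) (hK : Fintype.card K = q ^ n)
    (hθ : Algebra.adjoin F {θ} = ⊤) (hn : 2 ≤ n) {d e t : ℕ} (hde : d * e + 1 = q ^ n)
    (hd : 1 ≤ d) (ht : 1 ≤ t) (hsize : (n + 1) * (d * t) ^ 2 + 2 * d ≤ q) (ζ : K) :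
    d * t * #(translatesPowEq F θ e ζ) ≤ q * (t + n + 1) := by
  classical
  obtain ⟨p, hp, f, hpp, hcard⟩ := FiniteField.card' F
  have : CharP K p := charP_of_injective_algebraMap (algebraMap F K).injective p
  have : ExpChar K p := ExpChar.prime hpp
  have hinj : Function.Injective fun x : F => θ + algebraMap F K x :=
    fun x y h => (algebraMap F K).injective (add_left_cancel h)
  rw [← card_image_of_injective _ hinj]
  have hqf : q = p ^ (f : ℕ) := hF.symm.trans hcard
  refine mul_card_le_of_pow_eq (p := p) (c := fun i => θ ^ q ^ i - θ) (ζ := ζ) hqf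
    (by omega) hde (by simp) (fun i hi hin => sub_ne_zero.mpr (pow_card_pow_ne_self hF hK hθ hi hin))
    ?_ ?_ ?_ hd ht hsize
  · intro u hu
    obtain ⟨x, -, rfl⟩ := mem_image.mp hu
    exact add_algebraMap_ne_zero hF hK hθ hn x
  · intro u hu i
    obtain ⟨x, -, rfl⟩ := mem_image.mp hu
    have hx : x ^ q ^ i = x := by rw [← hF, FiniteField.pow_card_pow]
    nth_rewrite 1 [hqf]
    rw [← pow_mul, add_pow_expChar_pow, pow_mul, ← hqf, ← map_pow, hx]
    ring
  · intro u hu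
    obtain ⟨x, hx, rfl⟩ := mem_image.mp hu
    exact mem_translatesPowEq.mp hx

theorem abs_card_translatesPowEq_one_sub_le (hF : Fintype.card F = q)
    (hK : Fintype.card K = q ^ n) (hθ : Algebra.adjoin F {θ} = ⊤) (hn : 2 ≤ n) {d t : ℕ}
    (hdvd : d ∣ q ^ n - 1) (hd : 1 ≤ d) (ht : 1 ≤ t)
    (hsize : (n + 1) * (d * t) ^ 2 + 2 * d ≤ q) :
    |(#(translatesPowEq F θ ((q ^ n - 1) / d) 1) : ℝ) - q / d| ≤ q * (n + 1) / t := by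
  classical
  set e := (q ^ n - 1) / d with he
  have hq1 : 0 < q ^ n := hK ▸ Fintype.card_pos
  have hde : d * e + 1 = q ^ n := by rw [he, Nat.mul_div_cancel' hdvd]; omega
  have hd' : (1 : ℝ) ≤ d := by exact_mod_cast hd
  have ht' : (1 : ℝ) ≤ t := by exact_mod_cast ht
  have hup : ∀ ζ : K,
      (#(translatesPowEq F θ e ζ) : ℝ) ≤ q / d + q * (n + 1) / (d * t) := by
    intro ζ
    have h : (d * t * #(translatesPowEq F θ e ζ) : ℝ) ≤ q * (t + n + 1) := by
      exact_mod_cast mul_card_translatesPowEq_le hF hK hθ hn hde hd ht hsize ζ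
    have h2 : (q : ℝ) / d + q * (n + 1) / (d * t) = q * (t + n + 1) / (d * t) := by
      field_simp
      ring
    rw [h2, le_div_iff₀ (by positivity)]
    linarith
  have hroots : #(nthRootsFinset d (1 : K)) ≤ d := by
    refine (Multiset.toFinset_card_le _).trans (card_nthRoots d 1)
  have hone : (1 : K) ∈ nthRootsFinset d (1 : K) := (mem_nthRootsFinset hd 1).mpr (one_pow d)
  have hsum : q = ∑ ζ ∈ nthRootsFinset d (1 : K), #(translatesPowEq F θ e ζ) := by
    rw [← hF, ← card_univ]
    refine (card_eq_sum_card_fiberwise (f := fun x : F => (θ + algebraMap F K x) ^ e)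
      fun x _ => ?_).trans (sum_congr rfl fun ζ _ => ?_)
    · rw [mem_coe, mem_nthRootsFinset hd, ← pow_mul, mul_comm e]
      have h := FiniteField.pow_card_sub_one_eq_one _ (add_algebraMap_ne_zero hF hK hθ hn x)
      rwa [hK, ← hde, Nat.add_sub_cancel] at h
    · rfl
  have hε : (0 : ℝ) ≤ q * (n + 1) / (d * t) := by positivity
  have hεd : d * ((q : ℝ) * (n + 1) / (d * t)) = q * (n + 1) / t := by field_simp
  have hlow : (q : ℝ) ≤
      #(translatesPowEq F θ e 1) + (d - 1) * (q / d + q * (n + 1) / (d * t)) := by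
    nth_rewrite 1 [hsum]
    rw [← add_sum_erase _ _ hone]
    push_cast
    gcongr
    refine (sum_le_card_nsmul _ _ _ fun ζ _ => hup ζ).trans ?_
    rw [nsmul_eq_mul]
    refine mul_le_mul_of_nonneg_right ?_ (by positivity)
    rw [card_erase_of_mem hone, Nat.cast_pred (card_pos.mpr ⟨1, hone⟩)]
    exact sub_le_sub_right (by exact_mod_cast hroots) 1
  have hqd : d * ((q : ℝ) / d) = q := by field_simp
  have h1 := hup 1
  rw [abs_le]
  constructor
  · nlinarith
  · nlinarith

/-- Distinct products of `n` translates of a generator `θ` are distinct, so few translates lie in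
a subgroup of large index. -/
theorem pow_mul_le_of_card_translatesPowEq_one (hF : Fintype.card F = q)
    (hK : Fintype.card K = q ^ n) (hθ : Algebra.adjoin F {θ} = ⊤) (hn : 1 ≤ n) {d : ℕ}
    (hdvd : d ∣ q ^ n - 1) :
    (#(translatesPowEq F θ ((q ^ n - 1) / d) 1) + 1 - n) ^ n * d ≤ n.factorial * q ^ n := by
  classical
  set e := (q ^ n - 1) / d with he
  set A := translatesPowEq F θ e 1
  have hq2 : 1 < q := hF ▸ Fintype.one_lt_card
  have hqn : 1 < q ^ n := Nat.one_lt_pow (by omega) hq2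
  have he0 : 0 < e := Nat.div_pos (Nat.le_of_dvd (by omega) hdvd)
    (Nat.pos_of_dvd_of_pos hdvd (by omega))
  have hprim : (minpoly F θ).natDegree = n := by
    rw [← finrank_eq_of_card hF hK]
    refine (Field.primitive_element_iff_minpoly_natDegree_eq F θ).mp ?_
    rw [← IntermediateField.toSubalgebra_inj, IntermediateField.top_toSubalgebra]
    exact top_le_iff.mp (hθ ▸ IntermediateField.algebra_adjoin_le_adjoin F {θ})
  let P : Finset F → F[X] := fun s => ∏ x ∈ s, (X - C (-x))
  have hPeval : ∀ s, aeval θ (P s) = ∏ x ∈ s, (θ + algebraMap F K x) := fun s => by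
    simp [P, map_prod]
  have hPmonic : ∀ s, (P s).Monic := fun s => monic_prod_of_monic _ _ fun x _ => monic_X_sub_C _
  have hPdeg : ∀ s, (P s).natDegree = #s := fun s => by
    rw [natDegree_prod_of_monic _ _ fun x _ => monic_X_sub_C _]
    simp only [natDegree_X_sub_C, sum_const, smul_eq_mul, mul_one]
  have hPmem : ∀ s x, x ∈ s ↔ (P s).eval (-x) = 0 := fun s x => by
    simp only [P, eval_prod, prod_eq_zero_iff, eval_sub, eval_X, eval_C]
    constructor
    · exact fun h => ⟨x, h, by ring⟩
    · rintro ⟨y, hy, hxy⟩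
      have : x = y := by linear_combination -hxy
      rwa [this]
  have hcard : #(powersetCard n A) ≤ #(nthRootsFinset e (1 : K)) := by
    refine card_le_card_of_injOn (fun s => aeval θ (P s)) ?_ ?_
    · intro s hs
      rw [mem_coe, mem_powersetCard] at hs
      rw [mem_coe, mem_nthRootsFinset he0]
      dsimp only
      rw [hPeval, ← prod_pow]
      exact prod_eq_one fun x hx => mem_translatesPowEq.mp (hs.1 hx)
    · intro s hs s' hs' h
      rw [mem_coe, mem_powersetCard] at hs hs'
      have hPP : P s = P s' := by
        by_contra hne
        have h0 : aeval θ (P s - P s') = 0 := by rw [map_sub, sub_eq_zero]; exact h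
        have h1 := minpoly.degree_le_of_ne_zero F θ (sub_ne_zero.mpr hne) h0
        have hdeg : (P s).degree = (P s').degree := by
          rw [degree_eq_natDegree (hPmonic s).ne_zero, degree_eq_natDegree (hPmonic s').ne_zero,
            hPdeg, hPdeg, hs.2, hs'.2]
        have h2 := degree_sub_lt_left hdeg (hPmonic s).ne_zero
          ((hPmonic s).leadingCoeff.trans (hPmonic s').leadingCoeff.symm)
        have h3 := h1.trans_lt h2
        rw [degree_eq_natDegree (minpoly.ne_zero (Algebra.IsIntegral.isIntegral θ)),
          degree_eq_natDegree (hPmonic s).ne_zero, hprim, hPdeg, hs.2] at h3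
        exact lt_irrefl _ h3
      ext x
      rw [hPmem, hPmem, hPP]
  have hroots : #(nthRootsFinset e (1 : K)) ≤ e :=
    (Multiset.toFinset_card_le _).trans (card_nthRoots e 1)
  rw [card_powersetCard] at hcard
  have h1 := Nat.pow_sub_le_descFactorial #A n
  rw [Nat.descFactorial_eq_factorial_mul_choose] at h1
  calc (#A + 1 - n) ^ n * d ≤ n.factorial * e * d :=
        Nat.mul_le_mul_right _ (h1.trans (Nat.mul_le_mul_left _ (hcard.trans hroots)))
    _ = n.factorial * (q ^ n - 1) := by rw [mul_assoc, he, Nat.div_mul_cancel hdvd]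
    _ ≤ n.factorial * q ^ n := Nat.mul_le_mul_left _ (Nat.sub_le _ _)

end Translates

section Sieve

variable {α : Type*} [Fintype α] {ι : α → ℕ} {r : ℕ} {q ε : ℝ}

/-- The Legendre sieve for the values of `ι` divisible by `r * D`. -/
theorem abs_card_sieve_sub_le (hr : 1 ≤ r) (P : Finset ℕ) (hP : ∀ l ∈ P, l.Prime) {D : ℕ}
    (hD : 1 ≤ D) (hPD : ∀ l ∈ P, l.Coprime D)
    (h : ∀ E, E ∣ ∏ l ∈ P, l →
      |(#{x | r * D * E ∣ ι x} : ℝ) - q / (r * D * E : ℕ)| ≤ ε) :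
    |(#{x | r * D ∣ ι x ∧ ∀ l ∈ P, ¬ r * l ∣ ι x} : ℝ) -
      q / (r * D : ℕ) * ∏ l ∈ P, (1 - 1 / (l : ℝ))| ≤ 2 ^ #P * ε := by
  classical
  induction P using Finset.induction_on generalizing D with
  | empty => simpa using h 1 (by simp)
  | insert l P hl ih =>
    have hlp : l.Prime := hP l (mem_insert_self _ _)
    have hP' : ∀ l ∈ P, l.Prime := fun l' hl' => hP l' (mem_insert_of_mem hl')
    rw [prod_insert hl] at h
    have h₁ := ih hP' hD (fun l' hl' => hPD l' (mem_insert_of_mem hl'))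
      (fun E hE => h E (hE.mul_left _))
    have h₂ := ih hP' (D := D * l) (Nat.mul_pos hD hlp.pos)
      (fun l' hl' => Nat.Coprime.mul_right (hPD l' (mem_insert_of_mem hl'))
        ((Nat.coprime_primes (hP' l' hl') hlp).mpr fun h => hl (h ▸ hl')))
      (fun E hE => by
        have := h (l * E) (Nat.mul_dvd_mul_left l hE)
        rwa [← mul_assoc, mul_assoc r D l] at this)
    have hmul : ∀ x, r * (D * l) ∣ ι x ↔ r * D ∣ ι x ∧ r * l ∣ ι x := by
      intro x
      constructor
      · intro hx
        exact ⟨(Dvd.intro l (by ring)).trans hx, (Dvd.intro D (by ring)).trans hx⟩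
      · rintro ⟨h1, h2⟩
        have := Nat.lcm_dvd h1 h2
        rwa [Nat.lcm_mul_left, Nat.Coprime.lcm_eq_mul
          (hPD l (mem_insert_self _ _)).symm] at this
    have hcard : #{x | r * D ∣ ι x ∧ ∀ l' ∈ P, ¬ r * l' ∣ ι x} =
        #{x | r * D ∣ ι x ∧ ∀ l' ∈ insert l P, ¬ r * l' ∣ ι x} +
          #{x | r * (D * l) ∣ ι x ∧ ∀ l' ∈ P, ¬ r * l' ∣ ι x} := by
      rw [← card_union_of_disjoint]
      · congr 1
        ext x
        simp only [mem_filter, mem_univ, true_and, mem_union, forall_mem_insert, hmul]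
        tauto
      · rw [disjoint_filter]
        rintro x - ⟨-, hx⟩ ⟨hx', -⟩
        exact hx l (mem_insert_self _ _) ((hmul x).mp hx').2
    have hcard' : (#{x | r * D ∣ ι x ∧ ∀ l' ∈ insert l P, ¬ r * l' ∣ ι x} : ℝ) =
        #{x | r * D ∣ ι x ∧ ∀ l' ∈ P, ¬ r * l' ∣ ι x} -
          #{x | r * (D * l) ∣ ι x ∧ ∀ l' ∈ P, ¬ r * l' ∣ ι x} := by
      rw [hcard]; push_cast; ring
    have hl0 : (l : ℝ) ≠ 0 := by exact_mod_cast hlp.ne_zero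
    have hr0 : (r : ℝ) ≠ 0 := by positivity
    have hD0 : (D : ℝ) ≠ 0 := by positivity
    have hmain : q / (r * D : ℕ) * ∏ l' ∈ insert l P, (1 - 1 / (l' : ℝ)) =
        q / (r * D : ℕ) * ∏ l' ∈ P, (1 - 1 / (l' : ℝ)) -
          q / (r * (D * l) : ℕ) * ∏ l' ∈ P, (1 - 1 / (l' : ℝ)) := by
      rw [prod_insert hl]
      push_cast
      field_simp
    rw [hcard', hmain, card_insert_of_notMem hl, pow_succ]
    rw [abs_le] at h₁ h₂ ⊢
    constructor <;> linarith [h₁.1, h₁.2, h₂.1, h₂.2]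

/-- A lower bound for the number of `x` with `ι x = r`: the small primes `P₁` are sieved out
exactly, the primes in `P₂` relative to them, and the primes in `P₃` trivially. -/
theorem le_card_sieve {P₁ P₂ P₃ : Finset ℕ} {η : ℝ} (hr : 1 ≤ r)
    (hP₁ : ∀ l ∈ P₁, l.Prime) (hP₂ : ∀ l ∈ P₂, l.Prime) (hdisj : Disjoint P₁ P₂)
    (h₁ : ∀ E, E ∣ ∏ l ∈ P₁, l → |(#{x | r * E ∣ ι x} : ℝ) - q / (r * E : ℕ)| ≤ ε)
    (h₂ : ∀ l ∈ P₂, ∀ E, E ∣ ∏ l ∈ P₁, l →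
      |(#{x | r * l * E ∣ ι x} : ℝ) - q / (r * l * E : ℕ)| ≤ ε)
    (h₃ : ∀ l ∈ P₃, (#{x | r * l ∣ ι x} : ℝ) ≤ η) :
    q / r * (∏ l ∈ P₁, (1 - 1 / (l : ℝ))) * (1 - ∑ l ∈ P₂, 1 / (l : ℝ)) -
      2 ^ #P₁ * (1 + #P₂) * ε - #P₃ * η ≤
      #{x | r ∣ ι x ∧ ∀ l ∈ P₁ ∪ P₂ ∪ P₃, ¬ r * l ∣ ι x} := by
  classical
  set V := ∏ l ∈ P₁, (1 - 1 / (l : ℝ)) with hV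
  have hB := (abs_le.mp (abs_card_sieve_sub_le (D := 1) hr P₁ hP₁ le_rfl
    (fun l _ => Nat.coprime_one_right l) (by simpa using h₁))).1
  simp only [mul_one] at hB
  have hB₂ : ∀ l ∈ P₂, (#{x | r * l ∣ ι x ∧ ∀ l' ∈ P₁, ¬ r * l' ∣ ι x} : ℝ) ≤
      q / r * V * (1 / l) + 2 ^ #P₁ * ε := by
    intro l hl
    have := (abs_le.mp (abs_card_sieve_sub_le (D := l) hr P₁ hP₁ (hP₂ l hl).one_le
      (fun l' hl' => (Nat.coprime_primes (hP₁ l' hl') (hP₂ l hl)).mpr fun h =>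
        disjoint_left.mp hdisj hl' (h ▸ hl)) (h₂ l hl))).2
    have hl0 : (l : ℝ) ≠ 0 := by exact_mod_cast (hP₂ l hl).ne_zero
    have hr0 : (r : ℝ) ≠ 0 := by positivity
    have hqr : q / (r * l : ℕ) * V = q / r * V * (1 / l) := by push_cast; field_simp
    rw [← hV, hqr] at this
    linarith
  have hsub : ({x | r ∣ ι x ∧ ∀ l ∈ P₁, ¬ r * l ∣ ι x} : Finset α) ⊆
      ({x | r ∣ ι x ∧ ∀ l ∈ P₁ ∪ P₂ ∪ P₃, ¬ r * l ∣ ι x} : Finset α) ∪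
        (P₂.biUnion fun l => {x | r * l ∣ ι x ∧ ∀ l' ∈ P₁, ¬ r * l' ∣ ι x}) ∪
        P₃.biUnion fun l => {x | r * l ∣ ι x} := by
    intro x hx
    simp only [mem_union, mem_filter, mem_univ, true_and, mem_biUnion] at hx ⊢
    by_cases hx₂ : ∃ l ∈ P₂, r * l ∣ ι x
    · obtain ⟨l, hl, hlx⟩ := hx₂
      exact Or.inl (Or.inr ⟨l, hl, hlx, hx.2⟩)
    by_cases hx₃ : ∃ l ∈ P₃, r * l ∣ ι x
    · exact Or.inr hx₃
    push Not at hx₂ hx₃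
    refine Or.inl (Or.inl ⟨hx.1, ?_⟩)
    rintro l ((hl | hl) | hl)
    exacts [hx.2 l hl, hx₂ l hl, hx₃ l hl]
  have hcard := (card_le_card hsub).trans ((card_union_le _ _).trans (add_le_add
    ((card_union_le _ _).trans (add_le_add le_rfl card_biUnion_le)) card_biUnion_le))
  have hcard' : (#{x | r ∣ ι x ∧ ∀ l ∈ P₁, ¬ r * l ∣ ι x} : ℝ) ≤
      #{x | r ∣ ι x ∧ ∀ l ∈ P₁ ∪ P₂ ∪ P₃, ¬ r * l ∣ ι x} +
        ∑ l ∈ P₂, (#{x | r * l ∣ ι x ∧ ∀ l' ∈ P₁, ¬ r * l' ∣ ι x} : ℝ) +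
        ∑ l ∈ P₃, (#{x | r * l ∣ ι x} : ℝ) := by exact_mod_cast hcard
  have hsum₂ := sum_le_sum hB₂
  have hsum₃ := sum_le_card_nsmul P₃ _ η h₃
  rw [sum_add_distrib, ← mul_sum, sum_const, nsmul_eq_mul] at hsum₂
  rw [nsmul_eq_mul] at hsum₃
  linarith

end Sieve

theorem pow_card_le_of_primeFactors {N b : ℕ} (hN : N ≠ 0) {P : Finset ℕ}
    (hP : P ⊆ N.primeFactors) (hb : ∀ l ∈ P, b ≤ l) : b ^ #P ≤ N :=
  calc b ^ #P ≤ ∏ l ∈ P, l := pow_card_le_prod _ _ _ hb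
    _ ≤ N := Nat.le_of_dvd (Nat.pos_of_ne_zero hN)
      ((prod_dvd_prod_of_subset _ _ _ hP).trans (Nat.prod_primeFactors_dvd N))

theorem prod_le_four_pow {P : Finset ℕ} {s : ℕ} (hP : ∀ l ∈ P, l.Prime ∧ l ≤ s) :
    ∏ l ∈ P, l ≤ 4 ^ s := by
  refine le_trans ?_ (primorial_le_four_pow s)
  refine prod_le_prod_of_subset_of_one_le' (fun l hl => ?_) fun l hl _ => ?_
  · rw [mem_filter, mem_range]
    exact ⟨Nat.lt_succ_of_le (hP l hl).2, (hP l hl).1⟩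
  · exact (mem_filter.mp hl).2.one_le

theorem inv_two_pow_le_prod {P : Finset ℕ} {s : ℕ} (hP : ∀ l ∈ P, l.Prime ∧ l ≤ s) :
    #P ≤ s ∧ ((2 : ℝ) ^ s)⁻¹ ≤ ∏ l ∈ P, (1 - 1 / (l : ℝ)) := by
  have hcard : #P ≤ s := by
    have : P ⊆ Icc 1 s := fun l hl => mem_Icc.mpr ⟨(hP l hl).1.one_le, (hP l hl).2⟩
    simpa using card_le_card this
  refine ⟨hcard, ?_⟩
  calc ((2 : ℝ) ^ s)⁻¹ ≤ (2 ^ #P)⁻¹ := by gcongr; norm_num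
    _ = ∏ l ∈ P, (1 / 2 : ℝ) := by rw [prod_const, one_div, inv_pow]
    _ ≤ _ := prod_le_prod (fun _ _ => by norm_num) fun l hl => by
      have : (2 : ℝ) ≤ l := by exact_mod_cast (hP l hl).1.two_le
      have : 1 / (l : ℝ) ≤ 1 / 2 := one_div_le_one_div_of_le (by norm_num) this
      linarith

section FinalEstimate

variable {n r s q X w : ℕ}

theorem sieve_main_term_gt (hr : 1 ≤ r) (hq : 0 < q) (hw : w = 2 ^ s)
    (hsize : 2 * r * (n + 1 + 2 * n * X) < w) {a b c : ℕ} {V S : ℝ} (ha : a ≤ s)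
    (hb : 2 * b ≤ s) (hc : c ≤ X) (hV : ((2 : ℝ) ^ s)⁻¹ ≤ V) (hS : S ≤ 1 / 2) :
    0 < q / r * V * (1 - S) - 2 ^ a * (1 + b) * ((q : ℝ) * (n + 1) / (w ^ 4 : ℕ)) -
      c * (2 * n * q / (w ^ 2 : ℕ)) := by
  have hsw : s < w := hw ▸ Nat.lt_two_pow_self
  have hq' : (0 : ℝ) < q := by exact_mod_cast hq
  have hr' : (0 : ℝ) < r := by exact_mod_cast hr
  have hw' : (0 : ℝ) < w := by rw [hw]; positivity
  have hw2 : ((2 : ℝ) ^ s) = w := by rw [hw]; push_cast; rfl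
  rw [hw2] at hV
  have hmain : (q : ℝ) / (2 * r * w) ≤ q / r * V * (1 - S) := by
    calc (q : ℝ) / (2 * r * w) = q / r * (w : ℝ)⁻¹ * (1 / 2) := by field_simp
      _ ≤ _ := by
        have h0 : (0 : ℝ) ≤ V := (inv_nonneg.mpr hw'.le).trans hV
        gcongr
        linarith
  have herr₁ : 2 ^ a * (1 + b) * ((q : ℝ) * (n + 1) / (w ^ 4 : ℕ)) ≤ q * (n + 1) / w ^ 2 := by
    have h1 : (2 : ℝ) ^ a ≤ w := hw2 ▸ pow_le_pow_right₀ (by norm_num) ha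
    have h2 : (1 + b : ℝ) ≤ w := by
      have : 1 + b ≤ w := by omega
      exact_mod_cast this
    calc _ ≤ (w : ℝ) * w * ((q : ℝ) * (n + 1) / (w ^ 4 : ℕ)) := by gcongr
      _ = q * (n + 1) / w ^ 2 := by push_cast; field_simp
  have herr₃ : (c : ℝ) * (2 * n * q / (w ^ 2 : ℕ)) ≤ q * (2 * n * X) / w ^ 2 := by
    calc _ ≤ (X : ℝ) * (2 * n * q / (w ^ 2 : ℕ)) := by gcongr
      _ = q * (2 * n * X) / w ^ 2 := by push_cast; ring
  have hfin : (q : ℝ) * (n + 1) / w ^ 2 + q * (2 * n * X) / w ^ 2 < q / (2 * r * w) := by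
    have h1 : (2 * r * (n + 1 + 2 * n * X) : ℝ) < w := by exact_mod_cast hsize
    rw [← add_div, div_lt_div_iff₀ (by positivity) (by positivity)]
    have h2 := mul_lt_mul_of_pos_left h1 (mul_pos hq' hw')
    linarith
  linarith

theorem sum_one_div_le_half {P : Finset ℕ} (hs : 1 ≤ s) (hP : ∀ l ∈ P, s ≤ l)
    (hcard : 2 * #P ≤ s) : ∑ l ∈ P, 1 / (l : ℝ) ≤ 1 / 2 := by
  have hs0 : (0 : ℝ) < s := by exact_mod_cast hs
  calc ∑ l ∈ P, 1 / (l : ℝ) ≤ #P • (1 / (s : ℝ)) := sum_le_card_nsmul _ _ _ fun l hl =>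
        one_div_le_one_div_of_le hs0 (by exact_mod_cast hP l hl)
    _ ≤ 1 / 2 := by
      rw [nsmul_eq_mul, mul_one_div, div_le_div_iff₀ hs0 two_pos]
      have : (2 * #P : ℝ) ≤ s := by exact_mod_cast hcard
      linarith

theorem two_mul_card_le_of_primeFactors {M : ℕ} (hM : M ≠ 0) (hMlt : M < 2 ^ (2 * X * s * n))
    (hs : 2 ^ (4 * X * n) ≤ s) {P : Finset ℕ} (hP : P ⊆ M.primeFactors)
    (hPs : ∀ l ∈ P, s ≤ l) : 2 * #P ≤ s := by
  have h1 := pow_card_le_of_primeFactors hM (b := s) hP hPs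
  have h2 : 2 ^ (4 * X * n * #P) < 2 ^ (2 * X * s * n) := by
    rw [pow_mul]
    exact (Nat.pow_le_pow_left hs _).trans_lt (h1.trans_lt hMlt)
  have h3 := (Nat.pow_lt_pow_iff_right one_lt_two).mp h2
  have h4 : 2 * X * n * (2 * #P) < 2 * X * n * s := by linarith
  exact (Nat.lt_of_mul_lt_mul_left h4).le

theorem card_le_of_primeFactors {M : ℕ} (hM : M ≠ 0) (hMlt : M < 2 ^ (2 * X * s * n))
    {P : Finset ℕ} (hP : P ⊆ M.primeFactors) (hPs : ∀ l ∈ P, (2 ^ s) ^ (2 * n) ≤ l) :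
    #P ≤ X := by
  have h1 := pow_card_le_of_primeFactors hM hP hPs
  have h2 : 2 ^ (2 * n * s * #P) < 2 ^ (2 * X * s * n) := by
    refine lt_of_le_of_lt (le_of_eq ?_) (h1.trans_lt hMlt)
    rw [← pow_mul, ← pow_mul]
    congr 1
    ring
  have h3 := (Nat.pow_lt_pow_iff_right one_lt_two).mp h2
  have h4 : 2 * n * s * #P < 2 * n * s * X := by linarith
  exact (Nat.lt_of_mul_lt_mul_left h4).le

end FinalEstimate

section Estimates

variable {F K : Type*} [Field F] [Field K] [Fintype F] [Fintype K] [Algebra F K]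
  {q n r w d : ℕ} {θ : K}

theorem abs_card_translatesPowEq_one_sub_le_of_le (hF : Fintype.card F = q)
    (hK : Fintype.card K = q ^ n) (hθ : Algebra.adjoin F {θ} = ⊤) (hn : 2 ≤ n) (hw1 : 1 ≤ w)
    (hwr : (n + 3) * r ^ 2 ≤ w) (hqw : w ^ (4 * n + 13) ≤ q) (hdvd : d ∣ q ^ n - 1) (hd1 : 1 ≤ d)
    (hd : d ≤ r * w ^ (2 * n + 2)) :
    |(#(translatesPowEq F θ ((q ^ n - 1) / d) 1) : ℝ) - (q : ℝ) / d| ≤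
      q * (n + 1) / (w ^ 4 : ℕ) := by
  refine abs_card_translatesPowEq_one_sub_le hF hK hθ hn hdvd hd1 (Nat.one_le_pow _ _ hw1) ?_
  have h1 : d * w ^ 4 ≤ r * w ^ (2 * n + 6) := by
    calc d * w ^ 4 ≤ r * w ^ (2 * n + 2) * w ^ 4 := Nat.mul_le_mul_right _ hd
      _ = r * w ^ (2 * n + 6) := by ring
  have h2 : d ≤ (d * w ^ 4) ^ 2 :=
    (Nat.le_mul_of_pos_right _ (by positivity)).trans (Nat.le_self_pow two_ne_zero _)
  calc (n + 1) * (d * w ^ 4) ^ 2 + 2 * d ≤ (n + 3) * (d * w ^ 4) ^ 2 := by linarith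
    _ ≤ (n + 3) * (r * w ^ (2 * n + 6)) ^ 2 := by gcongr
    _ = ((n + 3) * r ^ 2) * w ^ (4 * n + 12) := by ring
    _ ≤ w * w ^ (4 * n + 12) := Nat.mul_le_mul_right _ hwr
    _ = w ^ (4 * n + 13) := by ring
    _ ≤ q := hqw

theorem card_translatesPowEq_one_le_of_ge (hF : Fintype.card F = q)
    (hK : Fintype.card K = q ^ n) (hθ : Algebra.adjoin F {θ} = ⊤) (hn : 1 ≤ n) (hw1 : 1 ≤ w)
    (hqw : w ^ 2 ≤ q) (hdvd : d ∣ q ^ n - 1) (hd : w ^ (2 * n) ≤ d) :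
    (#(translatesPowEq F θ ((q ^ n - 1) / d) 1) : ℝ) ≤ 2 * n * q / (w ^ 2 : ℕ) := by
  have h := pow_mul_le_of_card_translatesPowEq_one hF hK hθ hn hdvd
  set b := #(translatesPowEq F θ ((q ^ n - 1) / d) 1)
  have h1 : ((b + 1 - n) * w ^ 2) ^ n ≤ (n * q) ^ n := by
    rw [mul_pow, mul_pow, ← pow_mul]
    refine (Nat.mul_le_mul_left _ hd).trans (h.trans ?_)
    exact Nat.mul_le_mul_right _ (Nat.factorial_le_pow n)
  have h2 := le_of_pow_le_pow_left₀ (by omega) (Nat.zero_le _) h1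
  have h4 : b * w ^ 2 ≤ 2 * n * q :=
    calc b * w ^ 2 ≤ ((b + 1 - n) + n) * w ^ 2 := Nat.mul_le_mul_right _ (by omega)
      _ = (b + 1 - n) * w ^ 2 + n * w ^ 2 := add_mul _ _ _
      _ ≤ n * q + n * q := Nat.add_le_add h2 (Nat.mul_le_mul_left _ hqw)
      _ = 2 * n * q := by ring
  rw [le_div_iff₀ (by positivity)]
  exact_mod_cast h4

end Estimates

theorem stmt_16 (n r : ℕ) (hn : 2 ≤ n) (hr : 1 ≤ r) :
    ∃ T : ℕ, ∀ q : ℕ, IsPrimePow q → T < q → r ∣ q ^ n - 1 →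
      ∀ (F K : Type) [Field F] [Field K] [Fintype F] [Fintype K] [Algebra F K],
        Fintype.card F = q → Fintype.card K = q ^ n →
          ∀ θ : K, Algebra.adjoin F {θ} = ⊤ →
            ∃ x : F, orderOf (θ + algebraMap F K x) = (q ^ n - 1) / r := by
  classical
  set X := 4 * n + 13 with hX
  set s₀ := 2 ^ (4 * X * n) + 2 * r * (n + 1 + 2 * n * X) + (n + 3) * r ^ 2 with hs₀
  refine ⟨2 ^ (X * s₀), fun q _ hTq hrN F K _ _ _ _ _ hF hK θ hθ => ?_⟩
  have hq0 : q ≠ 0 := ((Nat.zero_le _).trans_lt hTq).ne'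
  set s := Nat.log 2 q / X with hs
  have hs₀s : s₀ ≤ s := by
    rw [hs, Nat.le_div_iff_mul_le (by omega), mul_comm]
    exact Nat.le_log_of_pow_le one_lt_two hTq.le
  have hqlow : 2 ^ (X * s) ≤ q :=
    (Nat.pow_le_pow_right two_pos (Nat.mul_div_le _ _)).trans (Nat.pow_log_le_self 2 hq0)
  have hqup : q < 2 ^ (X * (s + 1)) :=
    (Nat.lt_pow_succ_log_self one_lt_two q).trans_le
      (Nat.pow_le_pow_right two_pos (Nat.lt_mul_div_succ _ (by omega)))
  have hs_big : 2 ^ (4 * X * n) ≤ s :=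
    ((Nat.le_add_right _ _).trans (Nat.le_add_right _ _)).trans hs₀s
  have hs1 : 1 ≤ s := Nat.one_le_two_pow.trans hs_big
  have hqn : q ^ n < 2 ^ (2 * X * s * n) := by
    refine (Nat.pow_lt_pow_left hqup (by omega)).trans_le ?_
    rw [← pow_mul]
    refine Nat.pow_le_pow_right two_pos (Nat.mul_le_mul_right _ ?_)
    calc X * (s + 1) ≤ X * (2 * s) := Nat.mul_le_mul_left _ (by omega)
      _ = 2 * X * s := by ring
  set w := 2 ^ s with hw
  have hsw : s < w := Nat.lt_two_pow_self
  have hw1 : 1 ≤ w := Nat.one_le_two_pow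
  have hqw : w ^ X ≤ q := by rw [hw, ← pow_mul, mul_comm s]; exact hqlow
  have hwbig : (n + 3) * r ^ 2 ≤ w := ((Nat.le_add_left _ _).trans hs₀s).trans hsw.le
  have hwbig' : 2 * r * (n + 1 + 2 * n * X) < w :=
    (((Nat.le_add_left _ _).trans (Nat.le_add_right _ _)).trans hs₀s).trans_lt hsw
  set N := q ^ n - 1 with hN
  have hq1 : 1 < q := hF ▸ Fintype.one_lt_card
  have hqn1 : 1 < q ^ n := Nat.one_lt_pow (by omega) hq1
  have hN0 : N ≠ 0 := by omega
  have hrN0 : N / r ≠ 0 := (Nat.div_pos (Nat.le_of_dvd (by omega) hrN) hr).ne'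
  have hNr : r * (N / r) = N := Nat.mul_div_cancel' hrN
  have hNrlt : N / r < q ^ n := (Nat.div_le_self _ _).trans_lt (by omega)
  let ι : F → ℕ := fun x => N / orderOf (θ + algebraMap F K x)
  have hord : ∀ x : F, orderOf (θ + algebraMap F K x) ∣ N := fun x => by
    refine orderOf_dvd_of_pow_eq_one ?_
    rw [hN, ← hK]
    exact FiniteField.pow_card_sub_one_eq_one _ (add_algebraMap_ne_zero hF hK hθ hn x)
  have hι : ∀ d, d ∣ N → ({x | d ∣ ι x} : Finset F) = translatesPowEq F θ (N / d) 1 := by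
    intro d hd
    ext x
    rw [mem_translatesPowEq, mem_filter, ← orderOf_dvd_iff_pow_eq_one,
      Nat.dvd_div_iff_mul_dvd (hord x), Nat.dvd_div_iff_mul_dvd hd, mul_comm]
    simp
  have hdist : ∀ d, d ∣ N → d ≤ r * w ^ (2 * n + 2) →
      |(#{x | d ∣ ι x} : ℝ) - (q : ℝ) / d| ≤ q * (n + 1) / (w ^ 4 : ℕ) := fun d hdN hd => by
    rw [hι d hdN]
    exact abs_card_translatesPowEq_one_sub_le_of_le hF hK hθ hn hw1 hwbig hqw hdN
      (Nat.pos_of_dvd_of_pos hdN (Nat.pos_of_ne_zero hN0)) hd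
  have hlarge : ∀ d, d ∣ N → w ^ (2 * n) ≤ d →
      (#{x | d ∣ ι x} : ℝ) ≤ 2 * n * q / (w ^ 2 : ℕ) := fun d hdN hd => by
    rw [hι d hdN]
    exact card_translatesPowEq_one_le_of_ge hF hK hθ (by omega) hw1
      ((Nat.pow_le_pow_right hw1 (by omega)).trans hqw) hdN hd
  set P := (N / r).primeFactors with hP
  set P₁ := P.filter fun l => l ≤ s
  set P₂ := P.filter fun l => s < l ∧ l ≤ w ^ (2 * n)
  set P₃ := P.filter fun l => w ^ (2 * n) < l
  have hprime : ∀ l ∈ P, l.Prime := fun l hl => Nat.prime_of_mem_primeFactors hl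
  have hP₁ : ∀ l ∈ P₁, l.Prime ∧ l ≤ s := fun l hl =>
    ⟨hprime l (mem_filter.mp hl).1, (mem_filter.mp hl).2⟩
  have hP₂ : ∀ l ∈ P₂, l.Prime := fun l hl => hprime l (mem_filter.mp hl).1
  have hdisj : Disjoint P₁ P₂ := disjoint_filter.mpr fun l _ h h' => by omega
  have hprodP₁ : ∏ l ∈ P₁, l ≤ w ^ 2 := by
    refine (prod_le_four_pow hP₁).trans_eq ?_
    rw [hw, ← pow_mul, mul_comm s, pow_mul]; rfl
  have hprod0 : 0 < ∏ l ∈ P₁, l := prod_pos fun l hl => (hP₁ l hl).1.pos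
  have hdvd : ∀ Q ⊆ P, r * ∏ l ∈ Q, l ∣ N := fun Q hQ => by
    rw [← hNr]
    exact Nat.mul_dvd_mul_left r
      ((prod_dvd_prod_of_subset _ _ _ hQ).trans (Nat.prod_primeFactors_dvd _))
  have hsieve := le_card_sieve (ι := ι) (q := (q : ℝ)) (P₁ := P₁) (P₂ := P₂) (P₃ := P₃) hr
    (fun l hl => (hP₁ l hl).1) hP₂ hdisj
    (fun E hE => hdist (r * E) ((Nat.mul_dvd_mul_left r hE).trans (hdvd P₁ (filter_subset _ _)))
      (Nat.mul_le_mul_left r ((Nat.le_of_dvd hprod0 hE).trans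
        (hprodP₁.trans (Nat.pow_le_pow_right hw1 (by omega))))))
    (fun l hl E hE => hdist (r * l * E) (by
        have h1 := hdvd (insert l P₁) (insert_subset (mem_filter.mp hl).1 (filter_subset _ _))
        rw [prod_insert (disjoint_right.mp hdisj hl), ← mul_assoc] at h1
        exact (Nat.mul_dvd_mul_left _ hE).trans h1)
      (by
        have h1 := (mem_filter.mp hl).2.2
        calc r * l * E ≤ r * w ^ (2 * n) * w ^ 2 := by
              gcongr
              exact (Nat.le_of_dvd hprod0 hE).trans hprodP₁
          _ = r * w ^ (2 * n + 2) := by ring))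
    (fun l hl => hlarge (r * l) (by
        simpa using hdvd {l} (singleton_subset_iff.mpr (mem_filter.mp hl).1))
      ((mem_filter.mp hl).2.le.trans (Nat.le_mul_of_pos_left _ hr)))
  obtain ⟨hcard₁, hV⟩ := inv_two_pow_le_prod hP₁
  have hMlt := hNrlt.trans hqn
  have hP₂s : ∀ l ∈ P₂, s ≤ l := fun l hl => (mem_filter.mp hl).2.1.le
  have hcard₂ : 2 * #P₂ ≤ s :=
    two_mul_card_le_of_primeFactors hrN0 hMlt hs_big (filter_subset _ _) hP₂s
  have hcard₃ : #P₃ ≤ X := card_le_of_primeFactors hrN0 hMlt (filter_subset _ _)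
    fun l hl => (mem_filter.mp hl).2.le
  have hpos : (0 : ℝ) < #{x | r ∣ ι x ∧ ∀ l ∈ P₁ ∪ P₂ ∪ P₃, ¬ r * l ∣ ι x} :=
    (sieve_main_term_gt hr (by omega) hw hwbig' hcard₁ hcard₂ hcard₃ hV
      (sum_one_div_le_half hs1 hP₂s hcard₂)).trans_le hsieve
  obtain ⟨x, hx⟩ := card_pos.mp (Nat.cast_pos.mp hpos)
  simp only [mem_filter, mem_univ, true_and] at hx
  obtain ⟨⟨m, hm⟩, hx⟩ := hx
  refine ⟨x, ?_⟩
  have hιx : ι x * orderOf (θ + algebraMap F K x) = N := Nat.div_mul_cancel (hord x)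
  have hmr : m ∣ N / r := by
    rw [Nat.dvd_div_iff_mul_dvd hrN, ← hm]
    exact Dvd.intro _ hιx
  have hm1 : m = 1 := by
    by_contra hne
    obtain ⟨l, hl, hlm⟩ := Nat.exists_prime_and_dvd hne
    have hlP : l ∈ P := Nat.mem_primeFactors.mpr ⟨hl, hlm.trans hmr, hrN0⟩
    refine hx l ?_ (hm ▸ Nat.mul_dvd_mul_left r hlm)
    simp only [mem_union, P₁, P₂, P₃, mem_filter, hlP, true_and]
    omega
  rw [hm, hm1, mul_one] at hιx
  rw [← hιx, Nat.mul_div_cancel_left _ hr]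
end

section
/- Let q be a prime power, n ≥ 2, r | q^n − 1, θ a generator of F_{q^n}/F_q, α ∈ F_{q^n}^*, and let N(θ, α) denote the number of x ∈ F_q such that α(θ+x) is r-primitive. With u the radical of the part of q^n−1 coprime to r and A := s·f_1⋯f_k (the notation from the decomposition of r), one has |N(θ,α)/θ(u) − (q/r)·Π_{i=1}^k (1 − 1/p_i)| ≤ (A·d(u)/r)·(n−1)·√q, where θ(u) = φ(u)/u. -/
section CharacterSums

open Polynomial

theorem eq_zero_of_sum_mul_X_pow_mul_eq_zero {L ι : Type*} [Field L] [Fintype ι] (c : ℕ) (v : ι → ℕ)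
    (hv : ∀ a b, a ≠ b → v a + c ≤ v b ∨ v b + c ≤ v a) (B : ι → L[X])
    (hB : ∀ a, (B a).coeff 0 ≠ 0) (k : ι → L[X]) (hk : ∀ a, (k a).degree < c)
    (h : ∑ a, k a * (X ^ v a * B a) = 0) : k = 0 := by
  classical
  by_contra hne
  obtain ⟨b, hb⟩ := Function.ne_iff.mp hne
  obtain ⟨a, ha, hmin⟩ := Finset.exists_min_image (Finset.univ.filter fun a => k a ≠ 0) v
    ⟨b, by simpa using hb⟩
  have ha' : k a ≠ 0 := by simpa using ha
  have hdvd : X ^ (v a + c) ∣ k a * (X ^ v a * B a) := by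
    rw [← Finset.add_sum_erase _ _ (Finset.mem_univ a)] at h
    rw [eq_neg_of_add_eq_zero_left h, dvd_neg]
    refine Finset.dvd_sum fun b hb => ?_
    by_cases hkb : k b = 0
    · simp [hkb]
    have h1 : v a + c ≤ v b := by
      rcases hv a b (Finset.ne_of_mem_erase hb).symm with h1 | h1
      · exact h1
      · have h2 := hmin b (by simpa using hkb)
        have hc : c = 0 := by omega
        exact absurd (hk a) (by simp [hc, Nat.WithBot.lt_zero_iff, ha'])
    exact Dvd.dvd.mul_left (Dvd.dvd.mul_right (pow_dvd_pow X h1) _) _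
  have h2 : X ^ c ∣ k a * B a := by
    rw [pow_add, show k a * (X ^ v a * B a) = X ^ v a * (k a * B a) by ring] at hdvd
    exact (mul_dvd_mul_iff_left (pow_ne_zero _ X_ne_zero)).mp hdvd
  have hcop : IsCoprime (X ^ c : L[X]) (B a) := by
    refine IsCoprime.pow_left ?_
    rw [(Polynomial.irreducible_X).coprime_iff_not_dvd, X_dvd_iff]
    exact hB a
  have h3 := hcop.dvd_of_dvd_mul_right h2
  have h4 := degree_le_of_dvd h3 ha'
  rw [degree_X_pow] at h4
  exact absurd (hk a) (not_lt.mpr h4)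

theorem exists_sum_mul_hasseDeriv_eq_zero {L ι : Type*} [Field L] [Fintype ι] (A B : ι → L[X])
    (c D M : ℕ) (hD : ∀ a, (A a).natDegree + (B a).natDegree ≤ D)
    (hcard : M * (c + D) < Fintype.card ι * c) :
    ∃ k : ι → L[X], k ≠ 0 ∧ (∀ a, (k a).degree < c) ∧
      ∀ l < M, ∑ a, A a * hasseDeriv l (k a * B a) = 0 := by
  classical
  let Ψ : ℕ → (ι → degreeLT L c) →ₗ[L] L[X] := fun l =>
    ∑ a, LinearMap.mulLeft L (A a) ∘ₗ hasseDeriv l ∘ₗ LinearMap.mulRight L (B a) ∘ₗ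
      (degreeLT L c).subtype ∘ₗ LinearMap.proj a
  let Φ : (ι → degreeLT L c) →ₗ[L] (Fin M × Fin (c + D) → L) :=
    LinearMap.pi fun e => lcoeff L e.2 ∘ₗ Ψ e.1
  have hΨ : ∀ l k, Ψ l k = ∑ a, A a * hasseDeriv l ((k a : L[X]) * B a) := by
    intro l k
    simp [Ψ]
  have hker : LinearMap.ker Φ ≠ ⊥ := by
    apply LinearMap.ker_ne_bot_of_finrank_lt
    have : Module.finrank L (degreeLT L c) = c := by
      rw [(degreeLTEquiv L c).finrank_eq]; simp
    have h2 : Module.finrank L (ι → degreeLT L c) = Fintype.card ι * c := by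
      simp [Module.finrank_pi_fintype L, this]
    rw [h2]
    simpa using hcard
  obtain ⟨k, hk, hk0⟩ := Submodule.exists_mem_ne_zero_of_ne_bot hker
  refine ⟨fun a => k a, ?_, fun a => mem_degreeLT.mp (k a).2, fun l hl => ?_⟩
  · intro h
    apply hk0
    ext1 a
    exact Subtype.ext (congrFun h a)
  · rw [← hΨ]
    ext e
    by_cases he : e < c + D
    · have := congrFun (LinearMap.mem_ker.mp hk) (⟨l, hl⟩, ⟨e, he⟩)
      simpa [Φ] using this
    · rw [hΨ, coeff_zero, finsetSum_coeff]
      refine Finset.sum_eq_zero fun a _ => ?_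
      by_cases hka : (k a : L[X]) = 0
      · simp [hka]
      refine coeff_eq_zero_of_natDegree_lt ?_
      have h1 : (k a : L[X]).natDegree < c := by
        have := mem_degreeLT.mp (k a).2
        rwa [degree_eq_natDegree hka, Nat.cast_lt] at this
      have h2 := hD a
      have h3 := natDegree_hasseDeriv_le ((k a : L[X]) * B a) l
      have h4 := natDegree_mul_le (p := (k a : L[X])) (q := B a)
      have h5 := natDegree_mul_le (p := A a) (q := hasseDeriv l ((k a : L[X]) * B a))
      omega

theorem X_sub_C_pow_dvd_of_hasseDeriv {L : Type*} [Field L] (f : L[X]) (x : L) (M : ℕ)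
    (h : ∀ l < M, (hasseDeriv l f).eval x = 0) : (X - C x) ^ M ∣ f := by
  rw [X_sub_C_pow_dvd_iff, ← taylor_apply, X_pow_dvd_iff]
  intro l hl
  rw [taylor_coeff, h l hl]

theorem card_mul_le_natDegree {L : Type*} [Field L] (f : L[X]) (hf : f ≠ 0) (M : ℕ) (Z : Finset L)
    (h : ∀ x ∈ Z, (X - C x) ^ M ∣ f) : Z.card * M ≤ f.natDegree := by
  have h1 : ∏ x ∈ Z, (X - C x) ^ M ∣ f := by
    refine Finset.prod_dvd_of_coprime (fun x _ y _ hxy => ?_) h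
    exact IsCoprime.pow (pairwise_coprime_X_sub_C Function.injective_id hxy)
  have h2 := natDegree_le_of_dvd h1 hf
  rw [natDegree_prod_of_monic _ _ fun x _ => (monic_X_sub_C x).pow M] at h2
  simpa using h2

theorem X_sub_C_pow_dvd_pow_sub {L : Type*} [Field L] (p : ℕ) [Fact p.Prime] [CharP L p] (t : ℕ)
    (g : L[X]) (x : L) : (X - C x) ^ p ^ t ∣ g ^ p ^ t - C (g.eval x ^ p ^ t) := by
  rw [C_pow, ← sub_pow_char_pow]
  exact pow_dvd_pow_of_dvd (dvd_iff_isRoot.mpr (by simp)) _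

/-- Stepanov's bound for the fibres of `x ↦ g(x)^((Q-1)/d)` over a field with `Q = R²` elements. -/
theorem card_filter_pow_eq_mul_le {L : Type*} [Field L] [Fintype L] [DecidableEq L]
    (p t R w d D : ℕ)
    [Fact p.Prime] [CharP L p] (hR : R = p ^ t) (hQ : Fintype.card L = R ^ 2) (hw : d * w + 1 = R)
    (hw0 : 0 < w) (hd0 : 0 < d) (g₀ : L[X]) (hg₀ : g₀.coeff 0 ≠ 0) (hD : (X * g₀).natDegree ≤ D)
    (a : L) :
    (Finset.univ.filter fun x : L =>
      (X * g₀).eval x ≠ 0 ∧ (X * g₀).eval x ^ (w * (R + 1)) = a).card * (d * w) ≤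
      R ^ 2 * (w + 2 * D + 1) := by
  set g := X * g₀ with hg
  set c := w * (R + 1) with hc
  have hg₀ne : g₀ ≠ 0 := by rintro rfl; simp at hg₀
  have hD1 : 1 ≤ D := by
    refine le_trans ?_ hD
    rw [hg, natDegree_X_mul hg₀ne]; omega
  have hcd : c * d + 1 = R ^ 2 := by
    rw [hc, ← hw]; ring
  let ι := Fin (w + D + 1) × Fin d
  obtain ⟨k, hk0, hkdeg, hk⟩ := exists_sum_mul_hasseDeriv_eq_zero (ι := ι)
    (fun e => C (a ^ (e.2 : ℕ)) * X ^ (e.1 : ℕ) * g ^ (w * (d - 1 - e.2)))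
    (fun e => g ^ (w * (e.2 : ℕ))) c (D * (d * w) + (w + D + 1)) (d * w) (by
      rintro ⟨i, j⟩
      have h1 : (C (a ^ (j : ℕ)) * X ^ (i : ℕ) * g ^ (w * (d - 1 - j))).natDegree ≤
          i + w * (d - 1 - j) * D := by
        refine natDegree_mul_le.trans (add_le_add ?_ ?_)
        · exact (natDegree_C_mul_le _ _).trans (natDegree_X_pow_le _)
        · exact natDegree_pow_le.trans (Nat.mul_le_mul_left _ hD)
      have h2 : (g ^ (w * (j : ℕ))).natDegree ≤ w * j * D :=
        natDegree_pow_le.trans (Nat.mul_le_mul_left _ hD)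
      have h3 : w * (d - 1 - j) * D + w * j * D ≤ D * (d * w) := by
        rw [← add_mul, ← mul_add, mul_comm, mul_comm w]
        refine Nat.mul_le_mul_left _ (Nat.mul_le_mul_right _ ?_)
        omega
      have := i.2
      dsimp only
      omega) (by
      simp only [ι, Fintype.card_prod, Fintype.card_fin]
      have e1 : (w + D + 1) * d * c = d * w * c + (D + 1) * (d * w) * (R + 1) := by
        rw [hc]; ring
      rw [e1, mul_add]
      have hdw : 0 < d * w := Nat.mul_pos hd0 hw0
      have hwd : w ≤ d * w := Nat.le_mul_of_pos_left _ hd0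
      have : D * (d * w) + (w + D + 1) < (D + 1) * (R + 1) := by
        rw [← hw]; nlinarith
      nlinarith)
  set h : L[X] := ∑ e : ι, k e * (X ^ ((e.1 : ℕ) * R ^ 2) * g ^ (c * (e.2 : ℕ))) with hh
  have hne : h ≠ 0 := by
    intro h0
    apply hk0
    refine eq_zero_of_sum_mul_X_pow_mul_eq_zero c
      (fun e : ι => (e.1 : ℕ) * R ^ 2 + c * e.2) ?_ (fun e => g₀ ^ (c * (e.2 : ℕ))) ?_ k hkdeg ?_
    · have key : ∀ i j i' j' : ℕ, j < d → j' < d → i < i' →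
          i * R ^ 2 + c * j + c ≤ i' * R ^ 2 + c * j' := by
        intro i j i' j' hj _ hi
        have h1 : c * j + c ≤ c * d := by rw [← Nat.mul_succ]; exact Nat.mul_le_mul_left _ hj
        have h2 : (i + 1) * R ^ 2 ≤ i' * R ^ 2 := Nat.mul_le_mul_right _ hi
        rw [add_mul] at h2
        omega
      have key2 : ∀ j j' : ℕ, j < j' → c * j + c ≤ c * j' := by
        intro j j' hj
        rw [← Nat.mul_succ]; exact Nat.mul_le_mul_left _ hj
      rintro ⟨i, j⟩ ⟨i', j'⟩ hij
      dsimp only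
      rcases lt_trichotomy (i : ℕ) i' with h1 | h1 | h1
      · exact Or.inl (key _ _ _ _ j.2 j'.2 h1)
      · rcases lt_trichotomy (j : ℕ) j' with h2 | h2 | h2
        · left; have := key2 _ _ h2; rw [h1]; omega
        · exact absurd (Prod.ext (Fin.ext h1) (Fin.ext h2)) hij
        · right; have := key2 _ _ h2; rw [h1]; omega
      · exact Or.inr (key _ _ _ _ j'.2 j.2 h1)
    · intro e
      rw [coeff_zero_eq_eval_zero, eval_pow, ← coeff_zero_eq_eval_zero]
      exact pow_ne_zero _ hg₀
    · rw [← h0, hh]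
      refine Finset.sum_congr rfl fun e _ => ?_
      rw [hg, mul_pow, pow_add, mul_assoc]
  have hdeg : h.natDegree ≤ R ^ 2 * (w + 2 * D + 1) := by
    refine natDegree_sum_le_of_forall_le _ _ ?_
    rintro ⟨i, j⟩ -
    have h1 : (k (i, j)).natDegree ≤ c := natDegree_le_of_degree_le (hkdeg _).le
    have h2 : (X ^ ((i : ℕ) * R ^ 2) * g ^ (c * (j : ℕ))).natDegree ≤ i * R ^ 2 + c * j * D := by
      refine natDegree_mul_le.trans (add_le_add (natDegree_X_pow_le _) ?_)
      exact natDegree_pow_le.trans (Nat.mul_le_mul_left _ hD)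
    refine natDegree_mul_le.trans ((add_le_add h1 h2).trans ?_)
    have h3 : c + c * j * D ≤ c * d * D := by
      have := j.2
      calc c + c * j * D ≤ c * D + c * j * D := by nlinarith
        _ = c * (j + 1) * D := by ring
        _ ≤ c * d * D := by gcongr; omega
    have h4 : (i : ℕ) * R ^ 2 ≤ (w + D) * R ^ 2 := Nat.mul_le_mul_right _ (by have := i.2; omega)
    nlinarith
  refine (card_mul_le_natDegree h hne (d * w) _ fun x hx => ?_).trans hdeg
  simp only [Finset.mem_filter, Finset.mem_univ, true_and] at hx
  obtain ⟨hgx, hxa⟩ := hx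
  have hMR : d * w ≤ R := by omega
  have hMQ : d * w ≤ p ^ (t * 2) := by
    rw [pow_mul, ← hR, sq]; nlinarith
  have hXQ : (X - C x) ^ (d * w) ∣ X ^ R ^ 2 - C x := by
    have := X_sub_C_pow_dvd_pow_sub p (t * 2) X x
    rw [pow_mul, ← hR, eval_X, ← hQ, FiniteField.pow_card, hQ] at this
    refine (pow_dvd_pow _ ?_).trans this
    nlinarith
  have hgR : (X - C x) ^ (d * w) ∣ g ^ R - C (g.eval x ^ R) := by
    have := X_sub_C_pow_dvd_pow_sub p t g x
    rw [← hR] at this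
    exact (pow_dvd_pow _ hMR).trans this
  have hf : (X - C x) ^ (d * w) ∣ ∑ e : ι, C (a ^ (e.2 : ℕ) * x ^ (e.1 : ℕ) *
      g.eval x ^ (w * (d - 1 - e.2))) * (k e * g ^ (w * (e.2 : ℕ))) := by
    refine X_sub_C_pow_dvd_of_hasseDeriv _ _ _ fun l hl => ?_
    have := congrArg (eval x) (hk l hl)
    rw [eval_finsetSum, eval_zero] at this
    rw [map_sum, eval_finsetSum, ← this]
    refine Finset.sum_congr rfl fun e _ => ?_
    rw [← smul_eq_C_mul, map_smul]
    simp
  have hunit : IsUnit (C (g.eval x ^ (w * (d - 1)))) :=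
    (isUnit_iff_ne_zero.mpr (pow_ne_zero _ hgx)).map C
  rw [← hunit.dvd_mul_left]
  rw [← Ideal.Quotient.eq_zero_iff_dvd, map_sum] at hf
  rw [← Ideal.Quotient.eq_zero_iff_dvd, ← hf, hh, Finset.mul_sum, map_sum]
  rw [← Ideal.Quotient.eq_zero_iff_dvd, map_sub, sub_eq_zero] at hXQ hgR
  refine Finset.sum_congr rfl ?_
  rintro ⟨i, j⟩ -
  dsimp only
  have e1 : c * (j : ℕ) = R * (w * j) + w * j := by rw [hc]; ring
  have e2 : g.eval x ^ (w * (d - 1)) * (g.eval x ^ R) ^ (w * (j : ℕ)) =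
      a ^ (j : ℕ) * g.eval x ^ (w * (d - 1 - j)) := by
    rw [← hxa, ← pow_mul, ← pow_mul, ← pow_add, ← pow_add]
    congr 1
    obtain ⟨m, hm⟩ : ∃ m, d - 1 = j + m := ⟨d - 1 - j, by have := j.2; omega⟩
    rw [hm, Nat.add_sub_cancel_left]
    ring
  rw [show a ^ (j : ℕ) * x ^ (i : ℕ) * g.eval x ^ (w * (d - 1 - j)) =
    g.eval x ^ (w * (d - 1)) * (g.eval x ^ R) ^ (w * (j : ℕ)) * x ^ (i : ℕ) by rw [e2]; ring]
  rw [e1, pow_add, pow_mul g R, mul_comm (i : ℕ), pow_mul X]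
  simp only [map_mul, map_pow] at hXQ hgR ⊢
  rw [hXQ, hgR]
  ring

section MonicPolynomials

variable {F : Type*} [Field F]

theorem finite_degreeLT [Finite F] (m : ℕ) : Finite (degreeLT F m) :=
  Finite.of_equiv _ (degreeLTEquiv F m).toEquiv.symm

theorem monic_natDegree_iff_exists_degreeLT (m : ℕ) (f : F[X]) :
    (f.Monic ∧ f.natDegree = m) ↔ ∃ g : degreeLT F m, X ^ m + (g : F[X]) = f := by
  constructor
  · rintro ⟨hf, rfl⟩
    refine ⟨⟨f - X ^ f.natDegree, mem_degreeLT.mpr ?_⟩, by simp⟩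
    rw [← degree_eq_natDegree hf.ne_zero]
    refine degree_sub_lt_left ?_ hf.ne_zero (by simp [hf.leadingCoeff])
    rw [degree_X_pow, degree_eq_natDegree hf.ne_zero]
  · rintro ⟨g, rfl⟩
    have hg := mem_degreeLT.mp g.2
    refine ⟨monic_X_pow_add hg, natDegree_eq_of_degree_eq_some ?_⟩
    rw [degree_add_eq_left_of_degree_lt (by rwa [degree_X_pow]), degree_X_pow]

theorem finite_monic_natDegree [Finite F] (m : ℕ) :
    {f : F[X] | f.Monic ∧ f.natDegree = m}.Finite := by
  have := finite_degreeLT (F := F) m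
  refine (Set.finite_range fun g : degreeLT F m => X ^ m + (g : F[X])).subset fun f hf => ?_
  exact (monic_natDegree_iff_exists_degreeLT m f).mp hf

variable (F) in
/-- The monic polynomials of degree `m` over a finite field. -/
noncomputable def monicsOfDegree [Finite F] (m : ℕ) : Finset F[X] :=
  (finite_monic_natDegree (F := F) m).toFinset

theorem mem_monicsOfDegree [Finite F] {m : ℕ} {f : F[X]} :
    f ∈ monicsOfDegree F m ↔ f.Monic ∧ f.natDegree = m := by
  simp [monicsOfDegree]

open scoped Classical in
variable (F) in
/-- The monic irreducible polynomials of degree `m` over a finite field. -/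
noncomputable def irreduciblesOfDegree [Finite F] (m : ℕ) : Finset F[X] :=
  (monicsOfDegree F m).filter Irreducible

theorem mem_irreduciblesOfDegree [Finite F] {m : ℕ} {f : F[X]} :
    f ∈ irreduciblesOfDegree F m ↔ f.Monic ∧ f.natDegree = m ∧ Irreducible f := by
  simp [irreduciblesOfDegree, mem_monicsOfDegree, and_assoc]

open scoped Classical in
open UniqueFactorizationMonoid in
theorem sum_irreducible_pow_dvd [Finite F] {m : ℕ} {f : F[X]} (hf : f ∈ monicsOfDegree F m) :
    ∑ d ∈ Finset.Icc 1 m, ∑ j ∈ Finset.Icc 1 m, ∑ P ∈ irreduciblesOfDegree F d,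
      (if P ^ j ∣ f then d else 0) = m := by
  obtain ⟨hfm, hfd⟩ := mem_monicsOfDegree.mp hf
  have hcount : ∀ P : F[X], P.Monic → Irreducible P → ∀ j,
      P ^ j ∣ f ↔ j ≤ (normalizedFactors f).count P := by
    intro P hP hPi j
    rw [pow_dvd_iff_le_emultiplicity, emultiplicity_eq_count_normalizedFactors hPi hfm.ne_zero,
      hP.normalize_eq_self]
    norm_cast
  have hle : ∀ P : F[X], P.Monic → Irreducible P → (normalizedFactors f).count P ≤ m := by
    intro P hP hPi
    have h1 := (hcount P hP hPi _).mpr le_rfl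
    have h2 := natDegree_le_of_dvd h1 hfm.ne_zero
    rw [natDegree_pow, hfd] at h2
    exact (Nat.le_mul_of_pos_right _ hPi.natDegree_pos).trans h2
  have hmem : ∀ P ∈ normalizedFactors f, P.Monic ∧ Irreducible P := by
    intro P hP
    have hi := irreducible_of_normalized_factor P hP
    refine ⟨?_, hi⟩
    rw [← normalize_normalized_factor P hP]
    exact monic_normalize hi.ne_zero
  have hprod : (normalizedFactors f).prod = f := by
    rw [prod_normalizedFactors_eq hfm.ne_zero, hfm.normalize_eq_self]
  calc _ = ∑ d ∈ Finset.Icc 1 m, ∑ P ∈ irreduciblesOfDegree F d,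
        (normalizedFactors f).count P * P.natDegree := by
        refine Finset.sum_congr rfl fun d _ => ?_
        rw [Finset.sum_comm]
        refine Finset.sum_congr rfl fun P hP => ?_
        obtain ⟨hP, hPd, hPi⟩ := mem_irreduciblesOfDegree.mp hP
        rw [← Finset.sum_filter, Finset.sum_const, smul_eq_mul, hPd]
        congr 1
        have : (Finset.Icc 1 m).filter (fun j => P ^ j ∣ f) =
            Finset.Icc 1 ((normalizedFactors f).count P) := by
          ext j
          have := hle P hP hPi
          simp only [Finset.mem_filter, Finset.mem_Icc, hcount P hP hPi]
          omega
        rw [this]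
        simp
    _ = ∑ P ∈ (Finset.Icc 1 m).biUnion (irreduciblesOfDegree F),
        (normalizedFactors f).count P * P.natDegree := by
        rw [Finset.sum_biUnion]
        intro d _ e _ hde
        refine Finset.disjoint_left.mpr fun P hP hP' => hde ?_
        rw [← (mem_irreduciblesOfDegree.mp hP).2.1, (mem_irreduciblesOfDegree.mp hP').2.1]
    _ = ∑ P ∈ (normalizedFactors f).toFinset, (normalizedFactors f).count P * P.natDegree := by
        symm
        refine Finset.sum_subset (fun P hP => ?_) fun P _ hP => ?_
        · have hP' := Multiset.mem_toFinset.mp hP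
          obtain ⟨h1, h2⟩ := hmem P hP'
          simp only [Finset.mem_biUnion, Finset.mem_Icc]
          refine ⟨P.natDegree, ⟨h2.natDegree_pos, ?_⟩, mem_irreduciblesOfDegree.mpr ⟨h1, rfl, h2⟩⟩
          rw [← hfd]
          exact natDegree_le_of_dvd (dvd_of_mem_normalizedFactors hP') hfm.ne_zero
        · rw [Multiset.count_eq_zero_of_notMem fun h => hP (Multiset.mem_toFinset.mpr h), zero_mul]
    _ = m := by
        rw [← hfd]
        conv_rhs => rw [← hprod]
        rw [natDegree_multiset_prod_of_monic _ fun P hP => (hmem P hP).1,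
          Finset.sum_multiset_map_count]
        simp

/-- The coefficients of the logarithmic derivative of the `L`-function of `ψ`. -/
noncomputable def primePowerSum [Finite F] (ψ : F[X] →* ℂ) (k : ℕ) : ℂ :=
  ∑ e ∈ k.divisorsAntidiagonal, ∑ P ∈ irreduciblesOfDegree F e.1, (e.1 : ℂ) * ψ P ^ e.2

open scoped Classical in
theorem sum_monicsOfDegree_pow_dvd [Finite F] (ψ : F[X] →* ℂ) {m d : ℕ} (j : ℕ) {P : F[X]}
    (hP : P.Monic) (hPd : P.natDegree = d) :
    ∑ f ∈ monicsOfDegree F m, (if P ^ j ∣ f then ψ f else 0) =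
      if d * j ≤ m then ψ P ^ j * ∑ f ∈ monicsOfDegree F (m - d * j), ψ f else 0 := by
  have hPj : (P ^ j).natDegree = d * j := by rw [hP.natDegree_pow, hPd, mul_comm]
  have hPjm := hP.pow j
  split_ifs with h
  · rw [← Finset.sum_filter, Finset.mul_sum]
    symm
    refine Finset.sum_nbij (fun g => P ^ j * g) ?_ ?_ ?_ ?_
    · intro g hg
      obtain ⟨hg, hgd⟩ := mem_monicsOfDegree.mp hg
      rw [Finset.mem_filter, mem_monicsOfDegree, hPjm.natDegree_mul hg, hPj, hgd]
      exact ⟨⟨hPjm.mul hg, by omega⟩, dvd_mul_right _ _⟩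
    · intro g _ g' _ hgg
      exact mul_left_cancel₀ hPjm.ne_zero hgg
    · intro f hf
      obtain ⟨hf, g, rfl⟩ := Finset.mem_filter.mp hf
      obtain ⟨hf, hfd⟩ := mem_monicsOfDegree.mp hf
      have hg := hPjm.of_mul_monic_left hf
      rw [hPjm.natDegree_mul hg, hPj] at hfd
      exact ⟨g, mem_monicsOfDegree.mpr ⟨hg, by omega⟩, rfl⟩
    · intro g _
      rw [map_mul, map_pow]
  · refine Finset.sum_eq_zero fun f hf => if_neg fun hdvd => h ?_
    obtain ⟨hf, hfd⟩ := mem_monicsOfDegree.mp hf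
    rw [← hPj, ← hfd]
    exact natDegree_le_of_dvd hdvd hf.ne_zero

theorem mul_sum_monicsOfDegree [Finite F] (ψ : F[X] →* ℂ) (m : ℕ) :
    m * ∑ f ∈ monicsOfDegree F m, ψ f =
      ∑ k ∈ Finset.Icc 1 m, primePowerSum ψ k * ∑ f ∈ monicsOfDegree F (m - k), ψ f := by
  classical
  calc _ = ∑ f ∈ monicsOfDegree F m, ∑ d ∈ Finset.Icc 1 m, ∑ j ∈ Finset.Icc 1 m,
        ∑ P ∈ irreduciblesOfDegree F d, (d : ℂ) * (if P ^ j ∣ f then ψ f else 0) := by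
        rw [Finset.mul_sum]
        refine Finset.sum_congr rfl fun f hf => ?_
        conv_lhs => rw [← sum_irreducible_pow_dvd hf]
        push_cast
        simp_rw [Finset.sum_mul]
        refine Finset.sum_congr rfl fun d _ => Finset.sum_congr rfl fun j _ =>
          Finset.sum_congr rfl fun P _ => ?_
        split_ifs <;> simp
    _ = ∑ d ∈ Finset.Icc 1 m, ∑ j ∈ Finset.Icc 1 m, if d * j ≤ m then
        ∑ P ∈ irreduciblesOfDegree F d, (d : ℂ) * ψ P ^ j *
          ∑ f ∈ monicsOfDegree F (m - d * j), ψ f else 0 := by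
        rw [Finset.sum_comm]
        refine Finset.sum_congr rfl fun d _ => ?_
        rw [Finset.sum_comm]
        refine Finset.sum_congr rfl fun j _ => ?_
        rw [Finset.sum_comm]
        rw [Finset.sum_congr rfl (g := fun P => if d * j ≤ m then (d : ℂ) * ψ P ^ j *
          ∑ f ∈ monicsOfDegree F (m - d * j), ψ f else 0)]
        · split_ifs <;> simp
        · intro P hP
          obtain ⟨hP, hPd, -⟩ := mem_irreduciblesOfDegree.mp hP
          rw [← Finset.mul_sum, sum_monicsOfDegree_pow_dvd ψ j hP hPd]
          split_ifs <;> ring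
    _ = _ := by
        simp only [primePowerSum, Finset.sum_mul]
        rw [← Finset.sum_product', ← Finset.sum_filter]
        refine Eq.trans ?_ (Finset.sum_sigma' (Finset.Icc 1 m)
          (fun k => k.divisorsAntidiagonal) _).symm
        refine Finset.sum_nbij' (fun e => ⟨e.1 * e.2, e⟩) (fun e => e.2) ?_ ?_ ?_ ?_ ?_
        · rintro ⟨d, j⟩ h
          simp at h ⊢
          have : 0 < d * j := Nat.mul_pos h.1.1.1 h.1.2.1
          omega
        · rintro ⟨k, d, j⟩ h
          simp at h ⊢
          obtain ⟨⟨h1, h2⟩, rfl, h3⟩ := h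
          have hd : 0 < d := Nat.pos_of_ne_zero fun h => by simp [h] at h1
          have hj : 0 < j := Nat.pos_of_ne_zero fun h => by simp [h] at h1
          refine ⟨⟨⟨hd, ?_⟩, hj, ?_⟩, h2⟩ <;> nlinarith
        · intro e _; rfl
        · rintro ⟨k, d, j⟩ h
          simp at h ⊢
          exact h.2.1
        · rintro ⟨d, j⟩ h
          rfl

end MonicPolynomials

theorem sum_monicsOfDegree_eq_zero {F K : Type*} [Field F] [Field K] [Finite F] [Fintype K]
    [Algebra F K] (θ : K) (hθ : Algebra.adjoin F {θ} = ⊤) (χ : MulChar K ℂ) (hχ : χ ≠ 1) (m : ℕ)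
    (hm : Module.finrank F K ≤ m) :
    ∑ f ∈ monicsOfDegree F m, χ (aeval θ f) = 0 := by
  classical
  have := finite_degreeLT (F := F) m
  have := Fintype.ofFinite (degreeLT F m)
  have : Module.Finite F K := Module.Finite.of_finite
  have hsurj : ∀ y : K, ∃ g : degreeLT F m, aeval θ (g : F[X]) = y := by
    intro y
    have hy : y ∈ Algebra.adjoin F {θ} := hθ ▸ Algebra.mem_top
    rw [Algebra.adjoin_singleton_eq_range_aeval] at hy
    obtain ⟨f, rfl⟩ := hy
    have hint : IsIntegral F θ := Algebra.IsIntegral.isIntegral θ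
    refine ⟨⟨f %ₘ minpoly F θ, mem_degreeLT.mpr ?_⟩, ?_⟩
    · refine (degree_modByMonic_lt _ (minpoly.monic hint)).trans_le ?_
      refine degree_le_of_natDegree_le ((minpoly.natDegree_le θ).trans hm)
    · exact aeval_modByMonic_eq_self_of_root (minpoly.aeval F θ)
  have hsum : ∑ f ∈ monicsOfDegree F m, χ (aeval θ f) =
      ∑ g : degreeLT F m, χ (θ ^ m + aeval θ (g : F[X])) := by
    symm
    refine Finset.sum_nbij (fun g => X ^ m + (g : F[X])) ?_ ?_ ?_ ?_
    · intro g _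
      exact mem_monicsOfDegree.mpr ((monic_natDegree_iff_exists_degreeLT m _).mpr ⟨g, rfl⟩)
    · intro g _ g' _ h
      exact Subtype.ext (add_left_cancel h)
    · intro f hf
      obtain ⟨g, hg⟩ := (monic_natDegree_iff_exists_degreeLT m f).mp
        (mem_monicsOfDegree.mp hf)
      exact ⟨g, by simp, hg⟩
    · intro g _
      simp
  rw [hsum]
  set S := ∑ g : degreeLT F m, χ (θ ^ m + aeval θ (g : F[X])) with hS
  have hshift : ∀ y : K, ∑ g : degreeLT F m, χ (θ ^ m + aeval θ (g : F[X]) + y) = S := by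
    intro y
    obtain ⟨g₀, rfl⟩ := hsurj y
    refine Fintype.sum_equiv (Equiv.addRight g₀) _ _ fun g => ?_
    simp [add_assoc]
  have h0 : (Fintype.card K : ℂ) * S = 0 := by
    calc (Fintype.card K : ℂ) * S =
          ∑ y : K, ∑ g : degreeLT F m, χ (θ ^ m + aeval θ (g : F[X]) + y) := by
          simp [hshift]
      _ = ∑ g : degreeLT F m, ∑ y : K, χ y := by
          rw [Finset.sum_comm]
          refine Finset.sum_congr rfl fun g _ => ?_
          exact Fintype.sum_equiv (Equiv.addLeft _) _ _ fun y => rfl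
      _ = 0 := by simp [MulChar.sum_eq_zero_of_ne_one hχ]
  simpa using h0

theorem norm_le_of_norm_sum_pow_le {ι : Type*} [Fintype ι] (z : ι → ℂ) (C ρ : ℝ) (hρ : 0 < ρ)
    (h : ∀ k : ℕ, 1 ≤ k → ‖∑ i, z i ^ k‖ ≤ C * ρ ^ k) (i : ι) : ‖z i‖ ≤ ρ := by
  classical
  let ℓ : ℂ[X] := ∏ y ∈ (Finset.univ.image z).erase (z i), (X - Polynomial.C y)
  have hℓi : ℓ.eval (z i) ≠ 0 := by
    rw [eval_prod, Finset.prod_ne_zero_iff]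
    intro y hy
    simpa [sub_eq_zero] using (Finset.ne_of_mem_erase hy).symm
  have hℓj : ∀ j, z j ≠ z i → ℓ.eval (z j) = 0 := by
    intro j hj
    rw [eval_prod]
    exact Finset.prod_eq_zero (i := z j) (by simp [hj]) (by simp)
  set m := (Finset.univ.filter fun j => z j = z i).card with hm
  have hm1 : 1 ≤ m := Finset.card_pos.mpr ⟨i, by simp⟩
  have key : ∀ k : ℕ, (m : ℂ) * (z i ^ k * ℓ.eval (z i)) =
      ∑ j ∈ Finset.range (ℓ.natDegree + 1), ℓ.coeff j * ∑ a, z a ^ (k + j) := by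
    intro k
    calc (m : ℂ) * (z i ^ k * ℓ.eval (z i)) = ∑ a, z a ^ k * ℓ.eval (z a) := by
          rw [← Finset.sum_filter_add_sum_filter_not _ (fun j => z j = z i)]
          rw [Finset.sum_congr rfl (g := fun _ => z i ^ k * ℓ.eval (z i)), Finset.sum_const,
            Finset.sum_eq_zero, nsmul_eq_mul, add_zero]
          · intro j hj
            rw [hℓj j (by simpa using hj), mul_zero]
          · intro j hj
            rw [show z j = z i by simpa using hj]
      _ = _ := by
          simp_rw [eval_eq_sum_range, Finset.mul_sum]
          rw [Finset.sum_comm]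
          refine Finset.sum_congr rfl fun j _ => Finset.sum_congr rfl fun a _ => ?_
          ring
  set B : ℝ := ∑ j ∈ Finset.range (ℓ.natDegree + 1), ‖ℓ.coeff j‖ * (C * ρ ^ j) with hB
  have hbound : ∀ k : ℕ, 1 ≤ k → ‖z i‖ ^ k * ‖ℓ.eval (z i)‖ ≤ B * ρ ^ k := by
    intro k hk
    have h1 : ‖(m : ℂ) * (z i ^ k * ℓ.eval (z i))‖ ≤ B * ρ ^ k := by
      rw [key, hB, Finset.sum_mul]
      refine (norm_sum_le _ _).trans (Finset.sum_le_sum fun j _ => ?_)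
      rw [norm_mul, mul_assoc]
      refine mul_le_mul_of_nonneg_left ?_ (norm_nonneg _)
      refine (h (k + j) (by omega)).trans_eq ?_
      ring
    rw [norm_mul, norm_mul, norm_pow, Complex.norm_natCast] at h1
    refine le_trans ?_ h1
    have : (1 : ℝ) ≤ m := by exact_mod_cast hm1
    exact le_mul_of_one_le_left (by positivity) this
  by_contra hlt
  push Not at hlt
  have hr : 1 < ‖z i‖ / ρ := (one_lt_div hρ).mpr hlt
  have hpos : 0 < ‖ℓ.eval (z i)‖ := norm_pos_iff.mpr hℓi
  obtain ⟨k, hk⟩ := pow_unbounded_of_one_lt (B / ‖ℓ.eval (z i)‖) hr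
  have hk' : B / ‖ℓ.eval (z i)‖ < (‖z i‖ / ρ) ^ (k + 1) :=
    hk.trans (pow_lt_pow_right₀ hr (Nat.lt_succ_self k))
  rw [div_pow, div_lt_div_iff₀ hpos (by positivity)] at hk'
  exact absurd (hbound (k + 1) (by omega)) (not_le.mpr hk')

theorem exists_eq_neg_sum_pow (n : ℕ) (A Λ : ℕ → ℂ) (hA0 : A 0 = 1)
    (hA : ∀ m, n < m → A m = 0)
    (hΛ : ∀ m : ℕ, m * A m = ∑ k ∈ Finset.Icc 1 m, Λ k * A (m - k)) :
    ∃ ω : Fin n → ℂ, ∀ k, 1 ≤ k → Λ k = -∑ i, ω i ^ k := by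
  classical
  let B : ℂ[X] := ∑ j ∈ Finset.range (n + 1), Polynomial.C (A (n - j)) * X ^ j
  have hcoeff : ∀ j, j ≤ n → B.coeff j = A (n - j) := by
    intro j hj
    simp only [B, finsetSum_coeff, coeff_C_mul, coeff_X_pow]
    rw [Finset.sum_eq_single j]
    · simp
    · intro b _ hb; simp [hb.symm]
    · intro hj'; simp at hj'; omega
  have hdeg : B.natDegree = n := by
    refine natDegree_eq_of_le_of_coeff_ne_zero ?_ (by rw [hcoeff n le_rfl]; simp [hA0])
    refine natDegree_sum_le_of_forall_le _ _ fun j hj => (natDegree_C_mul_X_pow_le _ _).trans ?_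
    simp at hj; omega
  have hlead : B.leadingCoeff = 1 := by
    rw [leadingCoeff, hdeg, hcoeff n le_rfl]; simp [hA0]
  have hroots : B.roots.card = B.natDegree := (IsAlgClosed.splits B).natDegree_eq_card_roots.symm
  obtain ⟨ω, hω⟩ : ∃ ω : Fin n → ℂ, Finset.univ.val.map ω = B.roots := by
    have hl : B.roots.toList.length = n := by simp [hroots, hdeg]
    refine ⟨fun i => B.roots.toList.get (i.cast hl.symm), ?_⟩
    rw [Fin.univ_val_map]
    refine Eq.trans ?_ B.roots.coe_toList
    exact congrArg _ (List.ext_get (by simp [hl]) (by simp))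
  have hAe : ∀ m, A m = (-1) ^ m * MvPolynomial.aeval ω (MvPolynomial.esymm (Fin n) ℂ m) := by
    intro m
    rw [MvPolynomial.aeval_esymm_eq_multiset_esymm, hω]
    by_cases hm : m ≤ n
    · have := coeff_eq_esymm_roots_of_card hroots (k := n - m) (by omega)
      rw [hcoeff _ (by omega), hlead, hdeg, show n - (n - m) = m by omega] at this
      simpa using this
    · rw [hA m (by omega), Multiset.esymm, Multiset.powersetCard_eq_empty]
      · simp
      · rw [hroots, hdeg]; omega
  have hnewton : ∀ m : ℕ, m * A m = -∑ k ∈ Finset.Icc 1 m, (∑ i, ω i ^ k) * A (m - k) := by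
    intro m
    have h := congrArg (MvPolynomial.aeval ω) (MvPolynomial.mul_esymm_eq_sum (Fin n) ℂ m)
    simp only [map_mul, map_natCast, map_pow, map_neg, map_one, map_sum] at h
    rw [hAe m, mul_left_comm, h, ← mul_assoc, ← pow_add,
      show m + (m + 1) = 2 * m + 1 by ring, pow_succ, pow_mul, neg_one_sq, one_pow, one_mul,
      neg_one_mul]
    congr 1
    refine Finset.sum_nbij' (fun a => a.2) (fun k => (m - k, k)) ?_ ?_ ?_ ?_ ?_
    · rintro ⟨a, b⟩ h; simp at h ⊢; omega
    · intro k h; simp at h ⊢; omega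
    · rintro ⟨a, b⟩ h; simp at h ⊢; omega
    · intro k h; rfl
    · rintro ⟨a, b⟩ h
      simp at h
      rw [show m - b = a by omega, hAe a]
      simp [MvPolynomial.psum]
      ring
  refine ⟨ω, fun k => ?_⟩
  induction k using Nat.strong_induction_on with
  | _ k ih =>
    intro hk
    have h := (hΛ k).symm.trans (hnewton k)
    obtain ⟨k, rfl⟩ : ∃ j, k = j + 1 := ⟨k - 1, by omega⟩
    rw [Finset.sum_Icc_succ_top (by omega), Finset.sum_Icc_succ_top (by omega),
      Nat.sub_self, hA0, mul_one, mul_one, neg_add, ← Finset.sum_neg_distrib] at h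
    rw [Finset.sum_congr rfl fun j hj => ?_] at h
    · exact add_left_cancel h
    · have hj' := Finset.mem_Icc.mp hj
      rw [ih j (by omega) hj'.1, neg_mul]

section FrobeniusOrbits

variable {F L : Type*} [Field F] [Finite F] [Field L] [Algebra F L]

theorem exists_algHom_eq_pow_card_pow (i : ℕ) :
    ∃ φ : L →ₐ[F] L, ∀ x, φ x = x ^ Nat.card F ^ i := by
  have := Fintype.ofFinite F
  induction i with
  | zero => exact ⟨AlgHom.id F L, by simp⟩
  | succ i ih =>
    obtain ⟨φ, hφ⟩ := ih
    refine ⟨(FiniteField.frobeniusAlgHom F L).comp φ, fun x => ?_⟩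
    simp [hφ, pow_succ, pow_mul, Nat.card_eq_fintype_card]

theorem prod_sub_pow_eq_pow_geom_sum (n m : ℕ) (t x : L) (ht : t ^ Nat.card F ^ n = t) :
    ∏ i ∈ Finset.range (n * m), (t - x ^ Nat.card F ^ i) =
      (∏ i ∈ Finset.range n, (t ^ Nat.card F ^ (n - i) - x) ^ Nat.card F ^ i) ^
        ∑ a ∈ Finset.range m, (Nat.card F ^ n) ^ a := by
  induction m with
  | zero => simp
  | succ m ih =>
    rw [Nat.mul_succ, Finset.prod_range_add, ih, Finset.sum_range_succ, pow_add]
    congr 1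
    rw [← Finset.prod_pow]
    refine Finset.prod_congr rfl fun i hi => ?_
    have hi := Finset.mem_range.mp hi
    obtain ⟨φ, hφ⟩ := exists_algHom_eq_pow_card_pow (F := F) (L := L) (n * m + i)
    have ht' : ∀ j, t ^ (Nat.card F ^ n) ^ j = t := by
      intro j
      induction j with
      | zero => simp
      | succ j ih => rw [pow_succ, pow_mul, ih, ht]
    rw [← pow_mul, ← pow_mul, ← pow_add, add_comm i, ← hφ, ← hφ, map_sub, hφ (t ^ _), ← pow_mul,
      ← pow_add, show n - i + (n * m + i) = n * (m + 1) by rw [Nat.mul_succ]; omega,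
      pow_mul (Nat.card F), ht']

variable [Finite L]

theorem natDegree_minpoly_dvd_iff (x : L) (k : ℕ) :
    (minpoly F x).natDegree ∣ k ↔ x ^ Nat.card F ^ k = x := by
  have hint : IsIntegral F x := Algebra.IsIntegral.isIntegral x
  rw [(minpoly.irreducible hint).natDegree_dvd_iff_dvd_X_pow_card_pow_sub_X, minpoly.dvd_iff]
  simp [sub_eq_zero]

theorem aeval_minpoly_eq_prod (x t : L) :
    aeval t (minpoly F x) =
      ∏ i ∈ Finset.range (minpoly F x).natDegree, (t - x ^ Nat.card F ^ i) := by
  classical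
  have hint : IsIntegral F x := Algebra.IsIntegral.isIntegral x
  have hm := minpoly.monic hint
  have hinj : ∀ i j, i < j → j < (minpoly F x).natDegree →
      x ^ Nat.card F ^ i ≠ x ^ Nat.card F ^ j := by
    intro i j hij hj h
    obtain ⟨φ, hφ⟩ := exists_algHom_eq_pow_card_pow (F := F) (L := L) i
    rw [show j = (j - i) + i by omega, pow_add, pow_mul, ← hφ, ← hφ] at h
    have := (natDegree_minpoly_dvd_iff x (j - i)).mpr (φ.injective h).symm
    have := Nat.le_of_dvd (by omega) this
    omega
  have hdvd : ∏ i ∈ Finset.range (minpoly F x).natDegree, (X - C (x ^ Nat.card F ^ i)) ∣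
      (minpoly F x).map (algebraMap F L) := by
    refine Finset.prod_dvd_of_coprime (fun i hi j hj hij => ?_) fun i _ => ?_
    · refine isCoprime_X_sub_C_of_isUnit_sub (isUnit_iff_ne_zero.mpr (sub_ne_zero.mpr ?_))
      simp only [Finset.coe_range, Set.mem_Iio] at hi hj
      rcases lt_or_gt_of_ne hij with h | h
      · exact hinj i j h hj
      · exact (hinj j i h hi).symm
    · obtain ⟨φ, hφ⟩ := exists_algHom_eq_pow_card_pow (F := F) (L := L) i
      rw [dvd_iff_isRoot, IsRoot, eval_map_algebraMap, ← hφ, aeval_algHom_apply, minpoly.aeval,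
        map_zero]
  have hmp := monic_prod_of_monic (Finset.range (minpoly F x).natDegree)
    (fun i => X - C (x ^ Nat.card F ^ i)) fun i _ => monic_X_sub_C _
  have heq := eq_of_monic_of_dvd_of_natDegree_le hmp (hm.map (algebraMap F L)) hdvd (by
    rw [natDegree_map, natDegree_prod_of_monic _ _ fun i _ => monic_X_sub_C _]
    simp only [natDegree_X_sub_C, Finset.sum_const, Finset.card_range, smul_eq_mul, mul_one,
      le_refl])
  rw [← eval_map_algebraMap, heq, eval_prod]
  simp

theorem aeval_minpoly_pow_eq_prod (x t : L) :
    aeval t (minpoly F x) ^ (Module.finrank F L / (minpoly F x).natDegree) =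
      ∏ i ∈ Finset.range (Module.finrank F L), (t - x ^ Nat.card F ^ i) := by
  obtain ⟨e, he⟩ := minpoly.degree_dvd (K := F) (Algebra.IsIntegral.isIntegral x : IsIntegral F x)
  have hpos := minpoly.natDegree_pos (Algebra.IsIntegral.isIntegral x : IsIntegral F x)
  rw [he, Nat.mul_div_cancel_left _ hpos, aeval_minpoly_eq_prod]
  have hper := (natDegree_minpoly_dvd_iff (F := F) x _).mp dvd_rfl
  set D := (minpoly F x).natDegree
  clear he
  induction e with
  | zero => simp
  | succ e ih =>
    rw [pow_succ, ih, Nat.mul_succ, Finset.prod_range_add]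
    congr 1
    refine Finset.prod_congr rfl fun i _ => ?_
    have := (natDegree_minpoly_dvd_iff (F := F) x (D * e)).mp (dvd_mul_right _ _)
    rw [pow_add, pow_mul, this]

theorem card_filter_minpoly_eq [Fintype L] {P : F[X]} (hP : P.Monic)
    (hPi : Irreducible P) (hdvd : P.natDegree ∣ Module.finrank F L) [DecidableEq F[X]] :
    (Finset.univ.filter fun x : L => minpoly F x = P).card = P.natDegree := by
  classical
  have : Fintype F := Fintype.ofFinite F
  have hsep : P.Separable := PerfectField.separable_of_irreducible hPi
  have hsplit : (P.map (algebraMap F L)).Splits := by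
    have h1 := hPi.natDegree_dvd_iff_dvd_X_pow_card_pow_sub_X.mp hdvd
    rw [← Module.natCard_eq_pow_finrank, Nat.card_eq_fintype_card] at h1
    have h2 := FiniteField.isSplittingField_sub L F
    exact Splits.of_dvd h2.splits (by
      refine (Polynomial.map_ne_zero_iff (algebraMap F L).injective).mpr ?_
      exact FiniteField.X_pow_card_sub_X_ne_zero F Fintype.one_lt_card) (Polynomial.map_dvd _ h1)
  rw [← card_rootSet_eq_natDegree hsep hsplit, ← Set.toFinset_card]
  congr 1
  ext x
  simp only [Finset.mem_filter, Finset.mem_univ, true_and, Set.mem_toFinset, mem_rootSet]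
  constructor
  · rintro rfl
    exact ⟨hP.ne_zero, minpoly.aeval F x⟩
  · rintro ⟨-, hx⟩
    exact (minpoly.eq_of_irreducible_of_monic hPi hx hP).symm

theorem primePowerSum_finrank [Fintype L] (ψ : F[X] →* ℂ) :
    primePowerSum ψ (Module.finrank F L) =
      ∑ x : L, ψ (minpoly F x) ^ (Module.finrank F L / (minpoly F x).natDegree) := by
  classical
  have hk : 0 < Module.finrank F L := Module.finrank_pos
  set k := Module.finrank F L with hk'
  rw [primePowerSum, ← Nat.map_div_right_divisors, Finset.sum_map]
  have hdisj : Set.PairwiseDisjoint (k.divisors : Set ℕ) (irreduciblesOfDegree F) := by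
    intro d _ e _ hde
    refine Finset.disjoint_left.mpr fun P hP hP' => hde ?_
    rw [← (mem_irreduciblesOfDegree.mp hP).2.1, (mem_irreduciblesOfDegree.mp hP').2.1]
  rw [← Finset.sum_fiberwise_of_maps_to (s := Finset.univ)
    (t := k.divisors.biUnion (irreduciblesOfDegree F)) (g := fun x : L => minpoly F x),
    Finset.sum_biUnion hdisj]
  · refine Finset.sum_congr rfl fun d hd => Finset.sum_congr rfl fun P hP => ?_
    obtain ⟨hP, hPd, hPi⟩ := mem_irreduciblesOfDegree.mp hP
    rw [Finset.sum_congr rfl (g := fun _ => ψ P ^ (k / d))]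
    · rw [Finset.sum_const, card_filter_minpoly_eq hP hPi, hPd, nsmul_eq_mul]
      · rfl
      · rw [hPd]; exact Nat.dvd_of_mem_divisors hd
    · intro x hx
      rw [(Finset.mem_filter.mp hx).2, hPd]
  · intro x _
    have hint : IsIntegral F x := Algebra.IsIntegral.isIntegral x
    simp only [Finset.mem_biUnion, Nat.mem_divisors]
    exact ⟨_, ⟨minpoly.degree_dvd hint, hk.ne'⟩,
      mem_irreduciblesOfDegree.mpr ⟨minpoly.monic hint, rfl, minpoly.irreducible hint⟩⟩

end FrobeniusOrbits

theorem norm_mulChar_le_one {K : Type*} [Field K] [Finite K] (χ : MulChar K ℂ) (a : K) :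
    ‖χ a‖ ≤ 1 := by
  have := Fintype.ofFinite K
  rcases eq_or_ne a 0 with rfl | ha
  · simp [MulChar.map_zero]
  · refine (Complex.norm_eq_one_of_pow_eq_one (n := Fintype.card K - 1) ?_ ?_).le
    · rw [← map_pow, FiniteField.pow_card_sub_one_eq_one a ha, map_one]
    · have := Fintype.one_lt_card (α := K)
      omega

theorem norm_sum_mulChar_le {K T : Type*} [Field K] [Fintype K] [DecidableEq K] [Fintype T]
    (χ : MulChar K ℂ) (hχ : χ ≠ 1) (y : T → K) (B : ℝ) (n : ℕ)
    (hB : ∀ a, a ≠ 0 → ((Finset.univ.filter fun x => y x = a).card : ℝ) ≤ B)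
    (h0 : (Finset.univ.filter fun x => y x = 0).card ≤ n) :
    ‖∑ x, χ (y x)‖ ≤ (Fintype.card K - 1) * B - Fintype.card T + n := by
  set N : K → ℝ := fun a => ((Finset.univ.filter fun x => y x = a).card : ℝ) with hN
  have hsum : ∑ x, χ (y x) = ∑ a ∈ Finset.univ.erase 0, χ a * ((N a - B : ℝ) : ℂ) := by
    have h1 : ∑ x, χ (y x) = ∑ a, χ a * (N a : ℂ) := by
      rw [← Finset.sum_fiberwise_of_maps_to (t := Finset.univ) (g := y) (by simp)]
      refine Finset.sum_congr rfl fun a _ => ?_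
      rw [Finset.sum_congr rfl (g := fun _ => χ a), Finset.sum_const, nsmul_eq_mul, mul_comm]
      · simp [hN]
      · intro x hx; rw [(Finset.mem_filter.mp hx).2]
    have h2 : ∑ a, χ a * ((N a - B : ℝ) : ℂ) = ∑ a, χ a * (N a : ℂ) := by
      push_cast
      simp_rw [mul_sub, Finset.sum_sub_distrib, ← Finset.sum_mul,
        MulChar.sum_eq_zero_of_ne_one hχ]
      simp
    rw [h1, ← h2]
    exact (Finset.sum_erase _ (by simp [MulChar.map_zero])).symm
  have htot : ∑ a, N a = Fintype.card T := by
    have := Finset.card_eq_sum_card_fiberwise (s := Finset.univ) (t := Finset.univ) (f := y)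
      (by simp)
    rw [← Finset.card_univ, this]
    push_cast
    rfl
  have hcard : ((Finset.univ.erase (0 : K)).card : ℝ) = Fintype.card K - 1 := by
    rw [Finset.card_erase_of_mem (Finset.mem_univ _), Finset.card_univ,
      Nat.cast_sub Fintype.card_pos]
    simp
  rw [← Finset.add_sum_erase _ _ (Finset.mem_univ 0)] at htot
  have h0' : N 0 ≤ n := Nat.cast_le.mpr h0
  calc ‖∑ x, χ (y x)‖ ≤ ∑ a ∈ Finset.univ.erase 0, (B - N a) := by
        rw [hsum]
        refine (norm_sum_le _ _).trans (Finset.sum_le_sum fun a ha => ?_)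
        rw [norm_mul, Complex.norm_real, Real.norm_eq_abs, abs_sub_comm,
          abs_of_nonneg (sub_nonneg.mpr (hB a (Finset.ne_of_mem_erase ha)))]
        refine mul_le_of_le_one_left (sub_nonneg.mpr (hB a (Finset.ne_of_mem_erase ha))) ?_
        exact norm_mulChar_le_one χ a
    _ = (Fintype.card K - 1) * B - ∑ a ∈ Finset.univ.erase 0, N a := by
        rw [Finset.sum_sub_distrib, Finset.sum_const, nsmul_eq_mul, hcard]
    _ ≤ _ := by linarith

theorem exists_eval_X_mul_eq_prod {L : Type*} [Field L] (Q n : ℕ) (hn : 0 < n) (t : L)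
    (ht : t ^ Q ^ n = t) (hne : ∀ i, 0 < i → i < n → t ^ Q ^ i ≠ t) :
    ∃ g : L[X], g.coeff 0 ≠ 0 ∧ (X * g).natDegree ≤ ∑ i ∈ Finset.range n, Q ^ i ∧
      ∀ x, (X * g).eval (x - t) =
        ∏ i ∈ Finset.range n, (t ^ Q ^ (n - i) - x) ^ Q ^ i := by
  obtain ⟨m, rfl⟩ := Nat.exists_eq_add_of_lt hn
  rw [zero_add] at *
  refine ⟨-∏ i ∈ Finset.range m, (C (t ^ Q ^ (m - i) - t) - X) ^ Q ^ (i + 1), ?_, ?_, ?_⟩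
  · rw [coeff_zero_eq_eval_zero, eval_neg, neg_ne_zero, eval_prod, Finset.prod_ne_zero_iff]
    intro i hi
    have hi := Finset.mem_range.mp hi
    simp only [eval_pow, eval_sub, eval_C, eval_X, sub_zero]
    exact pow_ne_zero _ (sub_ne_zero.mpr (hne _ (by omega) (by omega)))
  · rw [mul_neg, natDegree_neg, Finset.sum_range_succ']
    refine natDegree_mul_le.trans ?_
    rw [natDegree_X, pow_zero, add_comm]
    refine Nat.add_le_add_right ((natDegree_prod_le _ _).trans (Finset.sum_le_sum fun i _ => ?_)) 1
    refine natDegree_pow_le.trans (mul_le_of_le_one_right' ?_)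
    exact (natDegree_sub_le _ _).trans (by simp)
  · intro x
    rw [Finset.prod_range_succ', eval_mul, eval_X, eval_neg, eval_prod]
    simp only [eval_pow, eval_sub, eval_C, eval_X, Nat.sub_zero, ht, pow_zero, pow_one,
      Nat.add_sub_add_right]
    rw [mul_neg, mul_comm, ← mul_neg, neg_sub]
    congr 1
    refine Finset.prod_congr rfl fun i _ => ?_
    congr 1
    ring

theorem stepanov_bound_le {d w R D n : ℝ} (hd : 0 < d) (hw : 1 ≤ w) (hR : 1 ≤ R)
    (h : d * w + 1 = R) (hD : 0 ≤ D) (hn : 0 ≤ n) :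
    d * (R ^ 2 * (w + 2 * D + 1) / (d * w)) - R ^ 2 + n ≤ ((2 * D + 1) * (d + 1) + n) * R := by
  have e1 : d * (R ^ 2 * (w + 2 * D + 1) / (d * w)) - R ^ 2 = R * ((2 * D + 1) * (R / w)) := by
    have : w ≠ 0 := by positivity
    field_simp
    ring
  have e2 : R / w ≤ d + 1 := by
    rw [div_le_iff₀ (by positivity)]
    linarith
  have : n ≤ n * R := le_mul_of_one_le_right hn hR
  have : R * ((2 * D + 1) * (R / w)) ≤ R * ((2 * D + 1) * (d + 1)) := by gcongr
  rw [e1]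
  linarith

theorem norm_primePowerSum_le {F K L : Type*} [Field F] [Field K] [Field L] [Finite F] [Fintype K]
    [Fintype L] [Algebra F K] [Algebra K L] [Algebra F L] [IsScalarTower F K L] (θ : K)
    (hθ : Algebra.adjoin F {θ} = ⊤) (χ : MulChar K ℂ) (hχ : χ ≠ 1) (k : ℕ) (hk : 0 < k)
    (hL : Module.finrank K L = 2 * k) :
    ‖primePowerSum (χ.toMonoidHom.comp (aeval (R := F) θ : F[X] →* K)) (Module.finrank F L)‖ ≤
      ((2 * (∑ i ∈ Finset.range (Module.finrank F K), Nat.card F ^ i) + 1) * Fintype.card K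
        + Module.finrank F K) * (Fintype.card K : ℝ) ^ k := by
  classical
  have : Fintype F := Fintype.ofFinite F
  set Q := Nat.card F with hQ
  set n := Module.finrank F K with hn
  have hn0 : 0 < n := Module.finrank_pos
  have hKQ : Fintype.card K = Q ^ n := by
    rw [← Nat.card_eq_fintype_card, Module.natCard_eq_pow_finrank (K := F)]
  have hFL : Module.finrank F L = n * (2 * k) := by rw [← Module.finrank_mul_finrank F K L, hL]
  set t : L := algebraMap K L θ with ht
  have hdeg : (minpoly F θ).natDegree = n :=
    (Field.primitive_element_iff_minpoly_natDegree_eq F θ).mp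
      (IntermediateField.adjoin_eq_top_of_algebra F {θ} hθ)
  have hdegt : (minpoly F t).natDegree = n := by
    rw [ht, minpoly.algebraMap_eq (algebraMap K L).injective, hdeg]
  have htn : t ^ Q ^ n = t := (natDegree_minpoly_dvd_iff (F := F) t n).mp hdegt.dvd
  obtain ⟨g, hg0, hgD, hg⟩ := exists_eval_X_mul_eq_prod Q n hn0 t htn (by
    intro i hi hin h
    rw [← natDegree_minpoly_dvd_iff, hdegt] at h
    exact absurd (Nat.le_of_dvd hi h) (by omega))
  set D := ∑ i ∈ Finset.range n, Q ^ i with hD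
  have hQ1 : 1 < Q := Finite.one_lt_card
  have hQn : 1 < Q ^ n := Nat.one_lt_pow hn0.ne' hQ1
  obtain ⟨d, hd⟩ : ∃ d, Q ^ n = d + 1 := ⟨Q ^ n - 1, by omega⟩
  have hd0 : 0 < d := by omega
  set w := ∑ a ∈ Finset.range k, (Q ^ n) ^ a with hw
  set R := (Q ^ n) ^ k with hR
  have hdw : d * w + 1 = R := by
    have h2 := geom_sum_mul_add d k
    rw [← hd] at h2
    rw [mul_comm, hR, ← h2]
  have hw0 : 0 < w := Finset.sum_pos (fun _ _ => by positivity) (by simpa using hk.ne')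
  have hc : ∑ a ∈ Finset.range (2 * k), (Q ^ n) ^ a = w * (R + 1) := by
    rw [two_mul, Finset.sum_range_add]
    simp only [pow_add, ← Finset.mul_sum]
    rw [← hw, ← hR]; ring
  have hcardL : Fintype.card L = R ^ 2 := by
    rw [← Nat.card_eq_fintype_card, Module.natCard_eq_pow_finrank (K := K), hL, hR, ← hKQ,
      Nat.card_eq_fintype_card]
    ring
  have hwR0 : w * (R + 1) ≠ 0 := mul_ne_zero hw0.ne' R.succ_ne_zero
  have hQi : ∀ i, Q ^ i ≠ 0 := fun i => pow_ne_zero _ (by omega)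
  have hdw0 : (0 : ℝ) < d * w := by exact_mod_cast Nat.mul_pos hd0 hw0
  have hR1 : (1 : ℝ) ≤ R := by exact_mod_cast Nat.one_le_iff_ne_zero.mpr (by omega)
  set y : L → K := fun x =>
    aeval θ (minpoly F x) ^ (Module.finrank F L / (minpoly F x).natDegree) with hy
  have hyG : ∀ x, algebraMap K L (y x) = (X * g).eval (x - t) ^ (w * (R + 1)) := by
    intro x
    rw [hg, ← hc, ← prod_sub_pow_eq_pow_geom_sum n (2 * k) t x htn, ← hFL,
      ← aeval_minpoly_pow_eq_prod, hy, map_pow, ht, aeval_algebraMap_apply]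
  obtain ⟨p, hp⟩ := CharP.exists F
  have hprime : Fact p.Prime := ⟨CharP.char_is_prime F p⟩
  have hpL : CharP L p := (Algebra.charP_iff F L p).mp hp
  obtain ⟨e, -, he⟩ := FiniteField.card F p
  have hstep : ∀ a, a ≠ 0 → ((Finset.univ.filter fun x => y x = a).card : ℝ) ≤
      R ^ 2 * (w + 2 * D + 1) / (d * w) := by
    intro a ha
    rw [le_div_iff₀ hdw0]
    have h1 := card_filter_pow_eq_mul_le p (e * (n * k)) R w d D
      (by rw [hR, hQ, Nat.card_eq_fintype_card, he, ← pow_mul, ← pow_mul]) hcardL hdw hw0 hd0 g hg0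
      hgD (algebraMap K L a)
    have h2 : (Finset.univ.filter fun x => y x = a).card ≤ (Finset.univ.filter fun x : L =>
        (X * g).eval x ≠ 0 ∧ (X * g).eval x ^ (w * (R + 1)) = algebraMap K L a).card := by
      refine Finset.card_le_card_of_injOn (fun x => x - t) ?_ (sub_left_injective.injOn)
      intro x hx
      simp only [Finset.coe_filter, Finset.mem_univ, true_and, Set.mem_ofPred_eq] at hx ⊢
      rw [← hyG, hx]
      refine ⟨fun h => ha ?_, rfl⟩
      have := hyG x
      rwa [h, zero_pow hwR0, hx, map_eq_zero] at this
    exact_mod_cast (Nat.mul_le_mul_right _ h2).trans h1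
  have hzero : (Finset.univ.filter fun x => y x = 0).card ≤ n := by
    refine (Finset.card_le_card (t := (Finset.range n).image fun i => t ^ Q ^ (n - i)) ?_).trans
      (Finset.card_image_le.trans (by simp))
    intro x hx
    have h1 := hyG x
    rw [(Finset.mem_filter.mp hx).2, map_zero, hg, eq_comm, pow_eq_zero_iff hwR0,
      Finset.prod_eq_zero_iff] at h1
    obtain ⟨i, hi, h1⟩ := h1
    exact Finset.mem_image.mpr ⟨i, hi, sub_eq_zero.mp (pow_eq_zero_iff (hQi i) |>.mp h1)⟩
  have hbound := norm_sum_mulChar_le χ hχ y _ n hstep hzero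
  rw [primePowerSum_finrank]
  have hrw : ∀ x : L, (χ.toMonoidHom.comp (aeval (R := F) θ : F[X] →* K)) (minpoly F x) ^
      (Module.finrank F L / (minpoly F x).natDegree) = χ (y x) := by
    intro x
    simp [hy]
  rw [Finset.sum_congr rfl fun x _ => hrw x]
  refine hbound.trans ?_
  have hdR : (Q : ℝ) ^ n = d + 1 := by exact_mod_cast hd
  have hwR : (d : ℝ) * w + 1 = R := by exact_mod_cast hdw
  have hw1 : (1 : ℝ) ≤ w := by exact_mod_cast hw0
  have hd0' : (0 : ℝ) < d := by exact_mod_cast hd0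
  rw [hcardL, hKQ]
  push_cast
  rw [hdR, add_sub_cancel_right]
  have e3 : (d + 1 : ℝ) ^ k = R := by rw [← hdR, hR]; push_cast; rfl
  rw [e3]
  exact stepanov_bound_le hd0' hw1 hR1 hwR D.cast_nonneg n.cast_nonneg

theorem norm_sum_mulChar_add_algebraMap_le {F K : Type*} [Field F] [Field K] [Fintype F]
    [Fintype K] [Algebra F K] (θ : K) (hθ : Algebra.adjoin F {θ} = ⊤) (χ : MulChar K ℂ)
    (hχ : χ ≠ 1) :
    ‖∑ x : F, χ (θ + algebraMap F K x)‖ ≤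
      (Module.finrank F K - 1) * Real.sqrt (Fintype.card F) := by
  set ψ : F[X] →* ℂ := χ.toMonoidHom.comp (aeval (R := F) θ : F[X] →* K) with hψ
  have hψa : ∀ f, ψ f = χ (aeval θ f) := fun f => rfl
  set n := Module.finrank F K with hn
  have hn0 : 0 < n := Module.finrank_pos
  obtain ⟨ω, hω⟩ := exists_eq_neg_sum_pow (n - 1)
    (fun m => ∑ f ∈ monicsOfDegree F m, ψ f) (primePowerSum ψ)
    (by
      rw [Finset.sum_eq_single_of_mem 1 (by simp [mem_monicsOfDegree])]
      · simp
      · intro f hf hf1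
        obtain ⟨hf, hf0⟩ := mem_monicsOfDegree.mp hf
        exact absurd (hf.natDegree_eq_zero.mp hf0) hf1)
    (fun m hm => sum_monicsOfDegree_eq_zero θ hθ χ hχ m (by omega))
    (fun m => mul_sum_monicsOfDegree ψ m)
  have hKQ : Fintype.card K = Fintype.card F ^ n := Module.card_eq_pow_finrank
  have hpow : ∀ i, ‖ω i ^ (n * 2)‖ ≤ Fintype.card K := by
    refine norm_le_of_norm_sum_pow_le (fun i => ω i ^ (n * 2))
      ((2 * (∑ i ∈ Finset.range n, Nat.card F ^ i : ℕ) + 1) * Fintype.card K + n)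
      (Fintype.card K) (Nat.cast_pos.mpr Fintype.card_pos) ?_
    intro k hk
    obtain ⟨p, hp⟩ := CharP.exists K
    have : Fact p.Prime := ⟨CharP.char_is_prime K p⟩
    have : NeZero (2 * k) := ⟨by omega⟩
    let L := FiniteField.Extension K p (2 * k)
    have : Fintype L := Fintype.ofFinite L
    let : Algebra F L := ((algebraMap K L).comp (algebraMap F K)).toAlgebra
    have : IsScalarTower F K L := IsScalarTower.of_algebraMap_eq fun _ => rfl
    have hL : Module.finrank K L = 2 * k := FiniteField.finrank_extension K p (2 * k)
    have hb := norm_primePowerSum_le (L := L) θ hθ χ hχ k hk hL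
    have hFL : Module.finrank F L = n * 2 * k := by
      rw [← Module.finrank_mul_finrank F K L, hL, mul_assoc]
    rw [hFL, hω _ (by nlinarith), norm_neg] at hb
    simpa only [pow_mul] using hb
  have hω' : ∀ i, ‖ω i‖ ≤ Real.sqrt (Fintype.card F) := by
    intro i
    have h := hpow i
    rw [norm_pow, mul_comm, pow_mul, hKQ, Nat.cast_pow] at h
    exact Real.le_sqrt_of_sq_le
      ((pow_le_pow_iff_left₀ (by positivity) (by positivity) hn0.ne').mp h)
  have h1 : primePowerSum ψ 1 = ∑ x : F, χ (θ + algebraMap F K x) := by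
    have := primePowerSum_finrank (F := F) (L := F) ψ
    rw [Module.finrank_self] at this
    rw [this, ← Equiv.sum_comp (Equiv.neg F)]
    refine Finset.sum_congr rfl fun x _ => ?_
    rw [show minpoly F ((Equiv.neg F) x) = X - C (-x) from minpoly.eq_X_sub_C' (-x)]
    simp [hψa]
  rw [← h1, hω 1 le_rfl, norm_neg]
  calc ‖∑ i, ω i ^ 1‖ ≤ ∑ _i : Fin (n - 1), Real.sqrt (Fintype.card F) :=
        norm_sum_le_of_le _ fun i _ => by simpa using hω' i
    _ = _ := by simp [Nat.cast_sub (Nat.succ_le_of_lt hn0)]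

/-- `HasCharacterExpansion f b` says that the function `f` on the unit group of `K` is a finite
linear combination of multiplicative characters of `K` whose coefficients have absolute values
adding up to at most `b`. -/
def HasCharacterExpansion {K : Type*} [Field K] (f : Kˣ → ℂ) (b : ℝ) : Prop :=
  ∃ (ι : Type) (_ : Fintype ι) (c : ι → ℂ) (χ : ι → MulChar K ℂ),
    (∀ β : Kˣ, f β = ∑ i, c i * χ i β) ∧ ∑ i, ‖c i‖ ≤ b

namespace HasCharacterExpansion

variable {K : Type*} [Field K] {f g : Kˣ → ℂ} {a b : ℝ}

theorem mono (h : HasCharacterExpansion f a) (hab : a ≤ b) : HasCharacterExpansion f b := by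
  obtain ⟨ι, _, c, χ, hf, hc⟩ := h
  exact ⟨ι, _, c, χ, hf, hc.trans hab⟩

theorem one : HasCharacterExpansion (1 : Kˣ → ℂ) 1 :=
  ⟨Unit, inferInstance, 1, 1, fun β => by simp, by simp⟩

theorem const_mul (h : HasCharacterExpansion f b) (z : ℂ) :
    HasCharacterExpansion (fun β => z * f β) (‖z‖ * b) := by
  obtain ⟨ι, _, c, χ, hf, hc⟩ := h
  refine ⟨ι, inferInstance, fun i => z * c i, χ, fun β => ?_, ?_⟩
  · simp_rw [hf β, Finset.mul_sum, mul_assoc]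
  · simp_rw [norm_mul, ← Finset.mul_sum]
    gcongr

theorem add (hf : HasCharacterExpansion f a) (hg : HasCharacterExpansion g b) :
    HasCharacterExpansion (fun β => f β + g β) (a + b) := by
  obtain ⟨ι, _, c, χ, hf, hc⟩ := hf
  obtain ⟨κ, _, d, η, hg, hd⟩ := hg
  refine ⟨ι ⊕ κ, inferInstance, Sum.elim c d, Sum.elim χ η, fun β => ?_, ?_⟩
  · simp [hf β, hg β]
  · simpa using add_le_add hc hd

theorem mul (hf : HasCharacterExpansion f a) (hg : HasCharacterExpansion g b) :
    HasCharacterExpansion (fun β => f β * g β) (a * b) := by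
  obtain ⟨ι, _, c, χ, hf, hc⟩ := hf
  obtain ⟨κ, _, d, η, hg, hd⟩ := hg
  refine ⟨ι × κ, inferInstance, fun i => c i.1 * d i.2, fun i => χ i.1 * η i.2,
    fun β => ?_, ?_⟩
  · beta_reduce
    rw [hf β, hg β, Finset.sum_mul_sum, Fintype.sum_prod_type]
    simp only [MulChar.mul_apply]
    exact Finset.sum_congr rfl fun i _ => Finset.sum_congr rfl fun j _ => by ring
  · simp_rw [norm_mul, Fintype.sum_prod_type, ← Finset.sum_mul_sum]
    have h0 : 0 ≤ ∑ i, ‖d i‖ := Finset.sum_nonneg fun _ _ => norm_nonneg _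
    exact mul_le_mul hc hd h0 ((Finset.sum_nonneg fun _ _ => norm_nonneg _).trans hc)

theorem prod {ι : Type*} (s : Finset ι) {f : ι → Kˣ → ℂ} {b : ι → ℝ}
    (h : ∀ i ∈ s, HasCharacterExpansion (f i) (b i)) :
    HasCharacterExpansion (fun β => ∏ i ∈ s, f i β) (∏ i ∈ s, b i) := by
  classical
  induction s using Finset.induction_on with
  | empty => exact one
  | insert i s hi ih =>
    simp_rw [Finset.prod_insert hi]
    exact (h i (Finset.mem_insert_self i s)).mul
      (ih fun j hj => h j (Finset.mem_insert_of_mem hj))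

theorem exists_mulChar_sum_pow_eq [Finite K] {t : ℕ} (ht : t ∣ Nat.card Kˣ) :
    ∃ χ : MulChar K ℂ, ∀ β : Kˣ,
      ∑ j ∈ Finset.range t, (χ ^ j) β = if orderOf β ∣ Nat.card Kˣ / t then (t : ℂ) else 0 := by
  classical
  have := Fintype.ofFinite K
  obtain ⟨m, hm⟩ := ht
  have hpos : 0 < Nat.card Kˣ := Nat.card_pos
  have ht0 : t ≠ 0 := by rintro rfl; simp at hm
  have hm0 : 0 < m := Nat.pos_of_ne_zero (by rintro rfl; simp at hm)
  have hprim := Complex.isPrimitiveRoot_exp t ht0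
  obtain ⟨ζ, hζ⟩ := hprim.isUnit ht0
  rw [← hζ] at hprim
  obtain ⟨g, hg⟩ := IsCyclic.exists_generator (α := Kˣ)
  have hζr : ζ ∈ rootsOfUnity (Fintype.card Kˣ) ℂ := by
    rw [← Nat.card_eq_fintype_card, mem_rootsOfUnity, Units.ext_iff, Units.val_pow_eq_pow_val, hm,
      pow_mul, hprim.pow_eq_one]
    simp
  refine ⟨MulChar.ofRootOfUnity hζr hg, fun β => ?_⟩
  obtain ⟨k, rfl⟩ := (mem_powers_iff_mem_zpowers.mpr (hg β) : β ∈ Submonoid.powers g)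
  have hval : ∀ j, (MulChar.ofRootOfUnity hζr hg ^ j) ((g ^ k : Kˣ) : K) = ((ζ : ℂ) ^ k) ^ j := by
    intro j
    rw [MulChar.pow_apply_coe, Units.val_pow_eq_pow_val, map_pow, MulChar.ofRootOfUnity_spec]
  simp_rw [hval]
  have hord : orderOf g = t * m := by rw [orderOf_eq_card_of_forall_mem_zpowers hg, hm]
  have hiff : orderOf (g ^ k) ∣ Nat.card Kˣ / t ↔ (ζ : ℂ) ^ k = 1 := by
    rw [hm, Nat.mul_div_cancel_left _ (Nat.pos_of_ne_zero ht0), orderOf_dvd_iff_pow_eq_one,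
      ← pow_mul, ← orderOf_dvd_iff_pow_eq_one, hord, hprim.pow_eq_one_iff_dvd,
      Nat.mul_dvd_mul_iff_right hm0]
  simp_rw [hiff]
  split_ifs with h
  · simp [h]
  · have := geom_sum_mul ((ζ : ℂ) ^ k) t
    rw [← pow_mul, mul_comm k, pow_mul, hprim.pow_eq_one, one_pow, sub_self] at this
    exact (mul_eq_zero.mp this).resolve_right (sub_ne_zero.mpr h)

theorem orderOf_dvd_card_div [Finite K] {t : ℕ} (ht : t ∣ Nat.card Kˣ) :
    HasCharacterExpansion
      (fun β : Kˣ => if orderOf β ∣ Nat.card Kˣ / t then (1 : ℂ) else 0) 1 := by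
  obtain ⟨χ, hχ⟩ := exists_mulChar_sum_pow_eq ht
  have ht0 : (t : ℂ) ≠ 0 := Nat.cast_ne_zero.mpr (ne_zero_of_dvd_ne_zero Nat.card_pos.ne' ht)
  refine ⟨Fin t, inferInstance, fun _ => 1 / t, fun j => χ ^ (j : ℕ), fun β => ?_, ?_⟩
  · rw [← Finset.mul_sum, Fin.sum_univ_eq_sum_range (fun j => (χ ^ j) (β : K)), hχ]
    split_ifs with h <;> simp [ht0, h]
  · have : (t : ℝ) ≠ 0 := by exact_mod_cast ht0
    simp [this]

theorem not_orderOf_dvd_card_div [Finite K] {t : ℕ} (ht : t ∣ Nat.card Kˣ) :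
    HasCharacterExpansion
      (fun β : Kˣ => if orderOf β ∣ Nat.card Kˣ / t then (0 : ℂ) else 1)
      (2 * (1 - 1 / t)) := by
  obtain ⟨χ, hχ⟩ := exists_mulChar_sum_pow_eq ht
  have ht0 := ne_zero_of_dvd_ne_zero Nat.card_pos.ne' ht
  obtain ⟨m, rfl⟩ := Nat.exists_eq_succ_of_ne_zero ht0
  have hc : ((m.succ : ℕ) : ℂ) ≠ 0 := Nat.cast_ne_zero.mpr ht0
  have hr : ((m.succ : ℕ) : ℝ) ≠ 0 := Nat.cast_ne_zero.mpr ht0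
  refine ⟨Fin (m + 1), inferInstance, Fin.cons (1 - 1 / (m.succ : ℕ)) fun _ => -1 / (m.succ : ℕ),
    fun j => χ ^ (j : ℕ), fun β => ?_, ?_⟩
  · have h := hχ β
    rw [← Fin.sum_univ_eq_sum_range (fun j => (χ ^ j) (β : K)), Fin.sum_univ_succ] at h
    rw [Fin.sum_univ_succ]
    simp only [Fin.cons_zero, Fin.cons_succ, ← Finset.mul_sum]
    rw [eq_sub_of_add_eq' h]
    split_ifs <;> field_simp <;> simp
  · rw [Fin.sum_univ_succ]
    simp only [Fin.cons_zero, Fin.cons_succ, Finset.sum_const, Finset.card_univ, Fintype.card_fin]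
    have h1 : ‖(1 - 1 / (m.succ : ℕ) : ℂ)‖ = 1 - 1 / (m.succ : ℕ) := by
      have h2 : (0 : ℝ) ≤ 1 - 1 / (m.succ : ℕ) := by
        rw [sub_nonneg, div_le_one (by positivity)]
        exact_mod_cast Nat.succ_pos m
      rw [← abs_of_nonneg h2, ← Real.norm_eq_abs, ← Complex.norm_real]
      push_cast
      rfl
    rw [h1, norm_div, norm_neg, norm_one, Complex.norm_natCast, nsmul_eq_mul]
    refine le_of_eq ?_
    field_simp
    push_cast
    ring

end HasCharacterExpansion

theorem sum_units_mulChar_eq {K : Type*} [Field K] [Fintype Kˣ] (χ : MulChar K ℂ)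
    [Decidable (χ = 1)] :
    ∑ β : Kˣ, χ β = if χ = 1 then (Fintype.card Kˣ : ℂ) else 0 := by
  split_ifs with h
  · simp [h]
  · obtain ⟨a, ha⟩ := MulChar.ne_one_iff.mp h
    have hs : χ a * ∑ β : Kˣ, χ β = ∑ β : Kˣ, χ β := by
      rw [Finset.mul_sum, ← Equiv.sum_comp (Equiv.mulLeft a) fun β : Kˣ => χ β]
      simp
    by_contra h0
    exact ha (mul_right_cancel₀ h0 (hs.trans (one_mul _).symm))

theorem HasCharacterExpansion.norm_sum_sub_le {F K : Type*} [Field F] [Field K] [Fintype F]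
    [Fintype K] [Fintype Kˣ] [Algebra F K] {f : Kˣ → ℂ} {b : ℝ} (h : HasCharacterExpansion f b)
    (θ : K) (hθ : Algebra.adjoin F {θ} = ⊤) (α : Kˣ) (y : F → Kˣ)
    (hy : ∀ x, (y x : K) = α * (θ + algebraMap F K x)) :
    ‖∑ x, f (y x) - Fintype.card F * ((∑ β, f β) / Fintype.card Kˣ)‖ ≤
      b * ((Module.finrank F K - 1) * Real.sqrt (Fintype.card F)) := by
  classical
  obtain ⟨ι, _, c, χ, hf, hc⟩ := h
  have hKu : (Fintype.card Kˣ : ℂ) ≠ 0 := Nat.cast_ne_zero.mpr Fintype.card_ne_zero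
  have hM : 0 ≤ (Module.finrank F K - 1) * Real.sqrt (Fintype.card F) := by
    refine mul_nonneg (sub_nonneg.mpr ?_) (Real.sqrt_nonneg _)
    exact_mod_cast (Module.finrank_pos : 0 < Module.finrank F K)
  have h1 : ∑ x, f (y x) = ∑ i, c i * ∑ x, χ i (y x) := by
    simp_rw [hf, Finset.mul_sum]
    exact Finset.sum_comm
  have h2 : (Fintype.card F : ℂ) * ((∑ β, f β) / Fintype.card Kˣ) =
      ∑ i, c i * if χ i = 1 then (Fintype.card F : ℂ) else 0 := by
    have : ∑ β, f β = ∑ i, c i * if χ i = 1 then (Fintype.card Kˣ : ℂ) else 0 := by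
      simp_rw [hf, ← sum_units_mulChar_eq, Finset.mul_sum]
      exact Finset.sum_comm
    rw [this, Finset.sum_div, Finset.mul_sum]
    refine Finset.sum_congr rfl fun i _ => ?_
    split_ifs
    · field_simp
    · simp
  rw [h1, h2, ← Finset.sum_sub_distrib]
  have h3 : ∀ i, ‖∑ x, χ i (y x) - if χ i = 1 then (Fintype.card F : ℂ) else 0‖ ≤
      (Module.finrank F K - 1) * Real.sqrt (Fintype.card F) := by
    intro i
    split_ifs with hi
    · simpa [hi] using hM
    · simp_rw [sub_zero, hy, map_mul, ← Finset.mul_sum, norm_mul]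
      exact (mul_le_of_le_one_left (norm_nonneg _) (norm_mulChar_le_one _ _)).trans
        (norm_sum_mulChar_add_algebraMap_le θ hθ (χ i) hi)
  calc ‖∑ i, (c i * ∑ x, χ i (y x) - c i * if χ i = 1 then (Fintype.card F : ℂ) else 0)‖
      ≤ ∑ i, ‖c i‖ * ((Module.finrank F K - 1) * Real.sqrt (Fintype.card F)) := by
        refine norm_sum_le_of_le _ fun i _ => ?_
        rw [← mul_sub, norm_mul]
        gcongr
        exact h3 i
    _ ≤ _ := by
        rw [← Finset.sum_mul]
        gcongr

theorem dvd_div_prime_pow_iff {N o p j : ℕ} (hN : N ≠ 0) (ho : o ∣ N) (hp : p.Prime)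
    (hj : j ≤ N.factorization p) :
    o ∣ N / p ^ j ↔ o.factorization p + j ≤ N.factorization p := by
  have hpj : p ^ j ∣ N := (hp.pow_dvd_iff_le_factorization hN).mpr hj
  have ho0 : o ≠ 0 := ne_zero_of_dvd_ne_zero hN ho
  rw [Nat.dvd_div_iff_mul_dvd hpj,
    ← Nat.factorization_le_iff_dvd (mul_ne_zero (pow_ne_zero _ hp.ne_zero) ho0) hN,
    Nat.factorization_mul (pow_ne_zero _ hp.ne_zero) ho0, hp.factorization_pow]
  refine ⟨fun h => by simpa [add_comm] using h p, fun h l => ?_⟩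
  rcases eq_or_ne l p with rfl | hl
  · simpa [add_comm] using h
  · simpa [Finsupp.single_apply, hl.symm] using (Nat.factorization_le_iff_dvd ho0 hN).mpr ho l

theorem eq_div_iff_factorization {N o r : ℕ} (hN : N ≠ 0) (ho : o ∣ N) (hr : r ∣ N) :
    o = N / r ↔ ∀ p ∈ N.primeFactors,
      o.factorization p = N.factorization p - r.factorization p := by
  refine ⟨fun h p _ => by simp [h, Nat.factorization_div hr], fun h => ?_⟩
  have hd : N / r ∣ N := Nat.div_dvd_of_dvd hr
  refine Nat.eq_of_factorization_eq (ne_zero_of_dvd_ne_zero hN ho)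
    (ne_zero_of_dvd_ne_zero hN hd) fun p => ?_
  by_cases hp : p ∈ N.primeFactors
  · simp [h p hp, Nat.factorization_div hr]
  · rw [Finsupp.notMem_support_iff.mp fun hm => hp (Nat.primeFactors_mono ho hN hm),
      Finsupp.notMem_support_iff.mp fun hm => hp (Nat.primeFactors_mono hd hN hm)]

/-- The contribution of a prime whose exponents in the group order and in `r` are `a` and `b`. -/
noncomputable def primeBound (p a b : ℕ) : ℝ :=
  if b = 0 then 2 * (1 - 1 / p) else if a = b then 1 else p

theorem hasCharacterExpansion_factorization {K : Type*} [Field K] [Finite K] {p b : ℕ}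
    (hp : p ∈ (Nat.card Kˣ).primeFactors) (hb : b ≤ (Nat.card Kˣ).factorization p) :
    HasCharacterExpansion
      (fun β : Kˣ => if (orderOf β).factorization p = (Nat.card Kˣ).factorization p - b
        then (1 : ℂ) else 0)
      (primeBound p ((Nat.card Kˣ).factorization p) b) := by
  set a := (Nat.card Kˣ).factorization p with ha
  have hN : Nat.card Kˣ ≠ 0 := Nat.card_pos.ne'
  have hpp := Nat.prime_of_mem_primeFactors hp
  have hdvd : ∀ {j}, j ≤ a → p ^ j ∣ Nat.card Kˣ := fun hj =>
    (hpp.pow_dvd_iff_le_factorization hN).mpr hj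
  have hiff : ∀ {j}, j ≤ a → ∀ β : Kˣ, orderOf β ∣ Nat.card Kˣ / p ^ j ↔
      (orderOf β).factorization p + j ≤ a := fun hj β =>
    dvd_div_prime_pow_iff hN (orderOf_dvd_natCard β) hpp hj
  have hle : ∀ β : Kˣ, (orderOf β).factorization p ≤ a := fun β =>
    (Nat.factorization_le_iff_dvd (orderOf_pos β).ne' hN).mpr (orderOf_dvd_natCard β) p
  have ha1 : 1 ≤ a := hpp.factorization_pos_of_dvd hN (Nat.dvd_of_mem_primeFactors hp)
  rw [primeBound]
  split_ifs with hb0 hab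
  · subst hb0
    convert HasCharacterExpansion.not_orderOf_dvd_card_div (K := K) (hdvd ha1) using 2 with β
    · have := hle β
      simp only [hiff ha1]
      split_ifs <;> first | rfl | omega
    · simp
  · convert HasCharacterExpansion.orderOf_dvd_card_div (K := K) (hdvd hb) using 2 with β
    simp only [hiff hb]
    split_ifs <;> first | rfl | omega
  · have hb1 : b + 1 ≤ a := by omega
    have h := (HasCharacterExpansion.orderOf_dvd_card_div (K := K) (hdvd hb)).add
      ((HasCharacterExpansion.orderOf_dvd_card_div (K := K) (hdvd hb1)).const_mul (-1))
    refine HasCharacterExpansion.mono (a := 1 + ‖(-1 : ℂ)‖ * 1) ?_ ?_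
    · convert h using 2 with β
      simp only [hiff hb, hiff hb1]
      split_ifs <;> first | omega | simp
    · have : (2 : ℝ) ≤ p := by exact_mod_cast hpp.two_le
      norm_num
      exact_mod_cast this

theorem hasCharacterExpansion_orderOf_eq {K : Type*} [Field K] [Finite K] {r : ℕ}
    (hr : r ∣ Nat.card Kˣ) :
    HasCharacterExpansion
      (fun β : Kˣ => if orderOf β = Nat.card Kˣ / r then (1 : ℂ) else 0)
      (∏ p ∈ (Nat.card Kˣ).primeFactors,
        primeBound p ((Nat.card Kˣ).factorization p) (r.factorization p)) := by
  have hN : Nat.card Kˣ ≠ 0 := Nat.card_pos.ne'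
  convert HasCharacterExpansion.prod (Nat.card Kˣ).primeFactors
    fun p hp => hasCharacterExpansion_factorization (K := K) hp
      ((Nat.factorization_le_iff_dvd (ne_zero_of_dvd_ne_zero hN hr) hN).mpr hr p) using 2 with β
  rw [Finset.prod_ite_zero, Finset.prod_const_one]
  simp only [eq_div_iff_factorization hN (orderOf_dvd_natCard β) hr]

theorem card_divisors_prod_primes (U : Finset ℕ) (hU : ∀ p ∈ U, p.Prime) :
    (∏ p ∈ U, p).divisors.card = 2 ^ U.card := by
  induction U using Finset.induction_on with
  | empty => simp
  | insert p U hp ih =>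
    have hU' := fun l hl => hU l (Finset.mem_insert_of_mem hl)
    have hpp := hU p (Finset.mem_insert_self p U)
    rw [Finset.prod_insert hp, Finset.card_insert_of_notMem hp, Nat.Coprime.card_divisors_mul,
      ih hU', hpp.divisors, Finset.card_pair hpp.one_lt.ne, pow_succ, mul_comm]
    refine Nat.Coprime.prod_right fun l hl => (Nat.coprime_primes hpp (hU' l hl)).mpr ?_
    rintro rfl
    exact hp hl

theorem totient_div_self_eq_prod {n : ℕ} (hn : n ≠ 0) :
    (n.totient : ℝ) / n = ∏ p ∈ n.primeFactors, (1 - 1 / (p : ℝ)) := by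
  have h : (n.totient : ℝ) = n * ∏ p ∈ n.primeFactors, (1 - (p : ℝ)⁻¹) := by
    have := congrArg (Rat.cast : ℚ → ℝ) (Nat.totient_eq_mul_prod_factors n)
    push_cast at this
    exact this
  have : (n : ℝ) ≠ 0 := Nat.cast_ne_zero.mpr hn
  rw [h, mul_div_cancel_left₀ _ this]
  simp

theorem prod_primeFactors_eq_mul_mul {M : Type*} [CommMonoid M] {N r : ℕ} (hN : N ≠ 0)
    (hr : r ∣ N) (g : ℕ → M) :
    ∏ p ∈ N.primeFactors, g p =
      (∏ p ∈ N.primeFactors.filter (fun p => r.factorization p = 0), g p) *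
      (∏ p ∈ N.primeFactors.filter
        (fun p => N.factorization p = r.factorization p ∧ 0 < r.factorization p), g p) *
      ∏ p ∈ N.primeFactors.filter
        (fun p => 0 < r.factorization p ∧ r.factorization p < N.factorization p), g p := by
  have hle : ∀ p, r.factorization p ≤ N.factorization p :=
    (Nat.factorization_le_iff_dvd (ne_zero_of_dvd_ne_zero hN hr) hN).mpr hr
  rw [Finset.prod_filter, Finset.prod_filter, Finset.prod_filter, ← Finset.prod_mul_distrib,
    ← Finset.prod_mul_distrib]
  refine Finset.prod_congr rfl fun p _ => ?_
  have := hle p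
  rcases Nat.eq_zero_or_pos (r.factorization p) with h | h
  · simp [h]
  · rcases this.eq_or_lt with h' | h'
    · simp [← h', h, h.ne']
    · simp [h, h.ne', h', h'.ne']

theorem prod_primeBound_div_eq {N r s u P : ℕ} (hN : N ≠ 0) (hr : r ∣ N)
    (hs : s = ∏ p ∈ N.primeFactors.filter
        (fun p => N.factorization p = r.factorization p ∧ 0 < r.factorization p),
      p ^ r.factorization p)
    (hu : u = ∏ p ∈ N.primeFactors.filter (fun p => r.factorization p = 0), p)
    (hP : P = ∏ p ∈ N.primeFactors.filter
        (fun p => 0 < r.factorization p ∧ r.factorization p < N.factorization p),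
      p ^ (r.factorization p + 1)) :
    (∏ p ∈ N.primeFactors, primeBound p (N.factorization p) (r.factorization p)) =
      ((s * P * u.divisors.card : ℕ) : ℝ) / r * ((u.totient : ℝ) / u) := by
  have hr0 := ne_zero_of_dvd_ne_zero hN hr
  have hprime : ∀ p ∈ N.primeFactors.filter (fun p => r.factorization p = 0), p.Prime := fun p hp =>
    Nat.prime_of_mem_primeFactors (Finset.mem_of_mem_filter p hp)
  have hu0 : u ≠ 0 := by
    rw [hu]
    exact Finset.prod_ne_zero_iff.mpr fun p hp => (hprime p hp).ne_zero
  have hrprod : r = s * ∏ p ∈ N.primeFactors.filter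
      (fun p => 0 < r.factorization p ∧ r.factorization p < N.factorization p),
        p ^ r.factorization p := by
    have h1 : ∏ p ∈ N.primeFactors, p ^ r.factorization p = r := by
      conv_rhs => rw [← Nat.prod_factorization_pow_eq_self hr0]
      exact (Finset.prod_subset (Nat.primeFactors_mono hr hN) fun p _ hp => by
        rw [Finsupp.notMem_support_iff.mp hp, pow_zero]).symm
    rw [prod_primeFactors_eq_mul_mul hN hr, ← hs, Finset.prod_eq_one, one_mul] at h1
    · exact h1.symm
    · intro p hp
      rw [(Finset.mem_filter.mp hp).2, pow_zero]
  have hsP : s * P = r * ∏ p ∈ N.primeFactors.filter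
      (fun p => 0 < r.factorization p ∧ r.factorization p < N.factorization p), p := by
    rw [hP]
    simp only [pow_succ, Finset.prod_mul_distrib]
    rw [← mul_assoc, ← hrprod]
  rw [prod_primeFactors_eq_mul_mul hN hr, totient_div_self_eq_prod hu0, hu,
    Nat.primeFactors_prod hprime, card_divisors_prod_primes _ hprime, hsP]
  have hrR : (r : ℝ) ≠ 0 := Nat.cast_ne_zero.mpr hr0
  rw [Finset.prod_congr rfl (g := fun p : ℕ => 2 * (1 - 1 / (p : ℝ))),
    Finset.prod_eq_one (s := Finset.filter (fun p => N.factorization p = r.factorization p ∧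
      0 < r.factorization p) _),
    Finset.prod_congr (s₁ := Finset.filter (fun p => 0 < r.factorization p ∧
      r.factorization p < N.factorization p) _) rfl (g := fun p : ℕ => (p : ℝ)),
    Finset.prod_mul_distrib, Finset.prod_const]
  · push_cast
    field_simp
  · intro p hp
    obtain ⟨-, h1, h2⟩ := Finset.mem_filter.mp hp
    rw [primeBound, if_neg h1.ne', if_neg h2.ne']
  · intro p hp
    obtain ⟨-, h1, h2⟩ := Finset.mem_filter.mp hp
    rw [primeBound, if_neg h2.ne', if_pos h1]
  · intro p hp
    rw [primeBound, if_pos (Finset.mem_filter.mp hp).2]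

theorem totient_div_div_eq {N r u : ℕ} (hN : N ≠ 0) (hr : r ∣ N)
    (hu : u = ∏ p ∈ N.primeFactors.filter (fun p => r.factorization p = 0), p) :
    ((N / r).totient : ℝ) / N = (u.totient : ℝ) / u * (1 / r * ∏ p ∈ N.primeFactors.filter
      (fun p => 0 < r.factorization p ∧ r.factorization p < N.factorization p),
        (1 - 1 / (p : ℝ))) := by
  have hr0 := ne_zero_of_dvd_ne_zero hN hr
  have hle : ∀ p, r.factorization p ≤ N.factorization p :=
    (Nat.factorization_le_iff_dvd hr0 hN).mpr hr
  have hprime : ∀ p ∈ N.primeFactors.filter (fun p => r.factorization p = 0), p.Prime := fun p hp =>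
    Nat.prime_of_mem_primeFactors (Finset.mem_of_mem_filter p hp)
  have hu0 : u ≠ 0 := by
    rw [hu]
    exact Finset.prod_ne_zero_iff.mpr fun p hp => (hprime p hp).ne_zero
  have hNr0 : N / r ≠ 0 := ne_zero_of_dvd_ne_zero hN (Nat.div_dvd_of_dvd hr)
  have hpf : (N / r).primeFactors =
      N.primeFactors.filter fun p => r.factorization p < N.factorization p := by
    ext p
    rw [← Nat.support_factorization, Finsupp.mem_support_iff, Nat.factorization_div hr,
      Finset.mem_filter, ← Nat.support_factorization, Finsupp.mem_support_iff, Finsupp.tsub_apply]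
    omega
  have hNR : (N : ℝ) ≠ 0 := Nat.cast_ne_zero.mpr hN
  have hrR : (r : ℝ) ≠ 0 := Nat.cast_ne_zero.mpr hr0
  have h1 := totient_div_self_eq_prod hNr0
  rw [hpf, Finset.prod_filter, prod_primeFactors_eq_mul_mul hN hr,
    Finset.prod_congr rfl (g := fun p : ℕ => 1 - 1 / (p : ℝ)),
    Finset.prod_eq_one (s := Finset.filter (fun p => N.factorization p = r.factorization p ∧
      0 < r.factorization p) _), mul_one, Finset.prod_congr (s₁ := Finset.filter (fun p =>
      0 < r.factorization p ∧ r.factorization p < N.factorization p) _) rfl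
      (g := fun p : ℕ => 1 - 1 / (p : ℝ)),
    Nat.cast_div hr hrR] at h1
  · rw [totient_div_self_eq_prod hu0, hu, Nat.primeFactors_prod hprime]
    calc ((N / r).totient : ℝ) / N = 1 / r * ((N / r).totient / (N / r : ℝ)) := by field_simp
      _ = _ := by rw [h1]; ring
  · intro p hp
    rw [if_pos (Finset.mem_filter.mp hp).2.2]
  · intro p hp
    rw [if_neg (Finset.mem_filter.mp hp).2.1.not_gt]
  · intro p hp
    obtain ⟨hp, h0⟩ := Finset.mem_filter.mp hp
    rw [if_pos]
    rw [h0]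
    exact (Nat.prime_of_mem_primeFactors hp).factorization_pos_of_dvd hN
      (Nat.dvd_of_mem_primeFactors hp)

end CharacterSums

theorem stmt_17 (q n r : ℕ) (hq : IsPrimePow q) (hn : 2 ≤ n)
    (hr : r ∣ q ^ n - 1)
    (s u P : ℕ)
    (hs : s = ∏ p ∈ (q ^ n - 1).primeFactors.filter
        (fun p => (q ^ n - 1).factorization p = r.factorization p ∧
          0 < r.factorization p), p ^ r.factorization p)
    (hu : u = ∏ p ∈ (q ^ n - 1).primeFactors.filter
        (fun p => r.factorization p = 0), p)
    (hP : P = ∏ p ∈ (q ^ n - 1).primeFactors.filter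
        (fun p => 0 < r.factorization p ∧
          r.factorization p < (q ^ n - 1).factorization p),
      p ^ (r.factorization p + 1))
    (F K : Type*) [Field F] [Field K] [Fintype F] [Fintype K] [Algebra F K]
    (hF : Fintype.card F = q) (hK : Fintype.card K = q ^ n)
    (θ : K) (hθ : Algebra.adjoin F {θ} = ⊤) (α : Kˣ)
    (Nθα : ℕ)
    (hN : Nθα = Nat.card
      {x : F // orderOf ((α : K) * (θ + algebraMap F K x)) = (q ^ n - 1) / r}) :
    |(Nθα : ℝ) / ((Nat.totient u : ℝ) / u) -
        ((q : ℝ) / r) *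
          ∏ p ∈ (q ^ n - 1).primeFactors.filter
            (fun p => 0 < r.factorization p ∧
              r.factorization p < (q ^ n - 1).factorization p),
            (1 - 1 / (p : ℝ))| ≤
      ((s * P * u.divisors.card : ℕ) : ℝ) / r * ((n : ℝ) - 1) * Real.sqrt q := by
  classical
  have hq1 : 1 < q := hq.one_lt
  have hfin : Module.finrank F K = n := by
    have h : Fintype.card K = Fintype.card F ^ Module.finrank F K := Module.card_eq_pow_finrank
    rw [hK, hF] at h
    exact (Nat.pow_right_injective hq1 h).symm
  have hcard : q ^ n - 1 = Nat.card Kˣ := by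
    rw [Nat.card_eq_fintype_card, Fintype.card_units, hK]
  have hne : ∀ x, θ + algebraMap F K x ≠ 0 := by
    intro x hx
    have hθx : θ = algebraMap F K (-x) := by
      rw [map_neg]
      exact eq_neg_of_add_eq_zero_left hx
    have hbot : (⊥ : Subalgebra F K) = ⊤ := by
      rw [← top_le_iff, ← hθ, hθx, Algebra.adjoin_le_iff, Set.singleton_subset_iff]
      exact Subalgebra.algebraMap_mem _ _
    have := Subalgebra.bot_eq_top_iff_finrank_eq_one.mp hbot
    omega
  set y : F → Kˣ := fun x => α * Units.mk0 _ (hne x) with hy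
  have hyv : ∀ x, (y x : K) = α * (θ + algebraMap F K x) := fun x => by simp [hy]
  have hNsum : (Nθα : ℂ) = ∑ x, if orderOf (y x) = Nat.card Kˣ / r then (1 : ℂ) else 0 := by
    rw [hN, Nat.card_eq_fintype_card, Fintype.card_subtype, hcard]
    simp_rw [← hyv, orderOf_units]
    simp
  rw [hcard] at hr hs hu hP ⊢
  have hN0 : Nat.card Kˣ ≠ 0 := Nat.card_pos.ne'
  have hu0 : u ≠ 0 := by
    rw [hu]
    exact Finset.prod_ne_zero_iff.mpr fun p hp =>
      (Nat.prime_of_mem_primeFactors (Finset.mem_of_mem_filter p hp)).ne_zero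
  have hφ : 0 < (u.totient : ℝ) / u := by
    have := Nat.totient_pos.mpr (Nat.pos_of_ne_zero hu0)
    positivity
  have hmain := (hasCharacterExpansion_orderOf_eq (K := K) hr).norm_sum_sub_le θ hθ α y hyv
  have htot : ∑ β : Kˣ, (if orderOf β = Nat.card Kˣ / r then (1 : ℂ) else 0) =
      (Nat.card Kˣ / r).totient := by
    rw [← IsCyclic.card_orderOf_eq_totient (α := Kˣ)
      (by rw [← Nat.card_eq_fintype_card]; exact Nat.div_dvd_of_dvd hr)]
    simp
  have hreal : ‖(Nθα : ℂ) - q * (((Nat.card Kˣ / r).totient : ℂ) / Fintype.card Kˣ)‖ =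
      |(Nθα : ℝ) - q * (((Nat.card Kˣ / r).totient : ℝ) / Nat.card Kˣ)| := by
    rw [← Real.norm_eq_abs, ← Complex.norm_real, Nat.card_eq_fintype_card]
    push_cast
    rfl
  rw [← hNsum, htot, hF, hreal, prod_primeBound_div_eq hN0 hr hs hu hP,
    totient_div_div_eq hN0 hr hu, hfin] at hmain
  set A := (u.totient : ℝ) / u
  set T := ∏ p ∈ (Nat.card Kˣ).primeFactors.filter (fun p => 0 < r.factorization p ∧
    r.factorization p < (Nat.card Kˣ).factorization p), (1 - 1 / (p : ℝ))
  have hfac : (Nθα : ℝ) / A - q / r * T = (Nθα - q * (A * (1 / r * T))) / A := by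
    field_simp
  rw [hfac, abs_div, abs_of_pos hφ, div_le_iff₀ hφ]
  refine hmain.trans_eq ?_
  ring
end
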